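/- arXiv:math/0401134 — 8 statements merged into one kernel-verified Lean document; each statement's English description precedes it below -/
import Mathlib

section
/- Let I be a σ-ideal on the Borel subsets of Cantor space 2^ℕ which is ccc, in which compact sets are dense, and which admits continuous reading of names. For a set a of finite binary sequences let B_a = { r ∈ 2^ℕ : r↾n ∈ a for infinitely many n }, and let Î = { a ⊆ 2^{<ℕ} : B_a ∈ I }. Then Î is a P-ideal: for every sequence (a_n) of sets in Î there is a set b ∈ Î such that a_n ∖ b is finite for every n. -/
open Set

/-- Cantor space `2^ℕ`. -/
abbrev Cantor := ℕ → Bool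

/-- `I` is a σ-ideal on the Borel subsets of Cantor space: all members are Borel,
it contains all singletons, is closed under Borel subsets and countable unions,
and does not contain the whole space. -/
def SigmaIdeal (I : Set (Set Cantor)) : Prop :=
  (∀ A ∈ I, MeasurableSet A) ∧
  (∀ x : Cantor, ({x} : Set Cantor) ∈ I) ∧
  (∀ A B : Set Cantor, MeasurableSet A → A ⊆ B → B ∈ I → A ∈ I) ∧
  (∀ A : ℕ → Set Cantor, (∀ n, A n ∈ I) → (⋃ n, A n) ∈ I) ∧
  (univ : Set Cantor) ∉ I

/-- `I` is ccc: every family of `I`-positive Borel sets with pairwise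
intersections in `I` is countable. -/
def Ccc (I : Set (Set Cantor)) : Prop :=
  ∀ 𝒜 : Set (Set Cantor), (∀ A ∈ 𝒜, MeasurableSet A ∧ A ∉ I) →
    (∀ A ∈ 𝒜, ∀ B ∈ 𝒜, A ≠ B → A ∩ B ∈ I) → 𝒜.Countable

/-- Compact sets are dense: every `I`-positive Borel set has an `I`-positive
compact subset. -/
def CompactDense (I : Set (Set Cantor)) : Prop :=
  ∀ A : Set Cantor, MeasurableSet A → A ∉ I → ∃ C : Set Cantor, IsCompact C ∧ C ⊆ A ∧ C ∉ I

/-- Continuous reading of names: for every `I`-positive Borel set `B` and Borel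
function `f : B → ℕ^ℕ` there is an `I`-positive compact `C ⊆ B` on which `f` is
continuous. -/
def ContReading (I : Set (Set Cantor)) : Prop :=
  ∀ B : Set Cantor, MeasurableSet B → B ∉ I → ∀ f : Cantor → (ℕ → ℕ), Measurable f →
    ∃ C : Set Cantor, IsCompact C ∧ C ⊆ B ∧ C ∉ I ∧ ContinuousOn f C

/-- `B_a`: the set of reals `r ∈ 2^ℕ` with `r↾n ∈ a` for infinitely many `n`. -/
def BSet (a : Set (List Bool)) : Set Cantor :=
  {r | {n : ℕ | (List.ofFn fun i : Fin n => r i) ∈ a}.Infinite}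

theorem measurableSet_ofFn_mem (a : Set (List Bool)) (k : ℕ) :
    MeasurableSet {r : Cantor | (List.ofFn fun i : Fin k => r i) ∈ a} := by
  have hres : Measurable fun (r : Cantor) (i : Fin k) => r i :=
    measurable_pi_lambda _ fun i => measurable_pi_apply _
  exact hres (MeasurableSet.of_discrete (s := {t : Fin k → Bool | List.ofFn t ∈ a}))

theorem measurableSet_BSet (a : Set (List Bool)) : MeasurableSet (BSet a) := by
  have h : BSet a =
      ⋂ m : ℕ, ⋃ k : ℕ, ⋃ _ : m < k, {r : Cantor | (List.ofFn fun i : Fin k => r i) ∈ a} := by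
    ext r
    simp only [BSet, mem_ofPred_eq, mem_iInter, mem_iUnion, exists_prop]
    constructor
    · intro hr m
      obtain ⟨k, hk, hmk⟩ := hr.exists_gt m
      exact ⟨k, hmk, hk⟩
    · intro hr
      refine infinite_of_forall_exists_gt fun m => ?_
      obtain ⟨k, hmk, hk⟩ := hr m
      exact ⟨k, hk, hmk⟩
  rw [h]
  exact .iInter fun m => .iUnion fun k => .iUnion fun _ => measurableSet_ofFn_mem a k

/-- `g` bounds, uniformly over `r ∈ C`, the lengths of initial segments of `r` lying in `a n`. -/
def BoundsSegments (a : ℕ → Set (List Bool)) (C : Set Cantor) (g : ℕ → ℕ) : Prop :=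
  ∀ r ∈ C, ∀ n k, (List.ofFn fun i : Fin k => r i) ∈ a n → k ≤ g n

open Classical in
/-- The supremum of the lengths of initial segments of `r` lying in `a n`
(with junk value `0` if there are infinitely many). -/
noncomputable def lastSegment (a : ℕ → Set (List Bool)) (r : Cantor) (n : ℕ) : ℕ :=
  ⨆ k : ℕ, if (List.ofFn fun i : Fin k => r i) ∈ a n then k else 0

theorem measurable_lastSegment (a : ℕ → Set (List Bool)) : Measurable (lastSegment a) := by
  refine measurable_pi_lambda _ fun n => Measurable.iSup fun k => ?_
  exact Measurable.ite (measurableSet_ofFn_mem (a n) k) measurable_const measurable_const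

theorem le_lastSegment {a : ℕ → Set (List Bool)} {r : Cantor} {n k : ℕ} (hr : r ∉ BSet (a n))
    (hk : (List.ofFn fun i : Fin k => r i) ∈ a n) : k ≤ lastSegment a r n := by
  obtain ⟨m, hm⟩ := (not_infinite.1 hr).bddAbove
  have hb : BddAbove (range fun k : ℕ =>
      open Classical in if (List.ofFn fun i : Fin k => r i) ∈ a n then k else 0) := by
    refine ⟨m, ?_⟩
    rintro _ ⟨j, rfl⟩
    dsimp only
    split_ifs with hj
    · exact hm hj
    · exact Nat.zero_le _
  exact (if_pos hk).ge.trans (le_ciSup hb k)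

theorem exists_boundsSegments {I : Set (Set Cantor)} (hcrn : ContReading I)
    {a : ℕ → Set (List Bool)} {B : Set Cantor} (hB : MeasurableSet B) (hBI : B ∉ I)
    (hBa : ∀ n, Disjoint B (BSet (a n))) :
    ∃ C, IsCompact C ∧ C ⊆ B ∧ C ∉ I ∧ ∃ g, BoundsSegments a C g := by
  obtain ⟨C, hC, hCB, hCI, hf⟩ := hcrn B hB hBI _ (measurable_lastSegment a)
  refine ⟨C, hC, hCB, hCI, ?_⟩
  have hbdd (n : ℕ) : ∃ m, ∀ r ∈ C, lastSegment a r n ≤ m := by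
    obtain ⟨m, hm⟩ := hC.bddAbove_image ((continuous_apply n).comp_continuousOn hf)
    exact ⟨m, fun r hr => hm (mem_image_of_mem _ hr)⟩
  choose g hg using hbdd
  exact ⟨g, fun r hr n k hk =>
    (le_lastSegment (disjoint_left.1 (hBa n) (hCB hr)) hk).trans (hg n r hr)⟩

/-- A positive-set property that is dense below `B` is witnessed by countably many sets which cover
`B` up to a set in the ideal. -/
theorem exists_countable_cover {I : Set (Set Cantor)} (hI : SigmaIdeal I) (hccc : Ccc I)
    {B : Set Cantor} (hB : MeasurableSet B) {P : Set Cantor → Prop}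
    (hP : ∀ A, MeasurableSet A → A ∉ I → A ⊆ B → ∃ C, MeasurableSet C ∧ C ⊆ A ∧ C ∉ I ∧ P C) :
    ∃ 𝒜 : Set (Set Cantor), 𝒜.Countable ∧ (∀ A ∈ 𝒜, P A) ∧ B \ ⋃₀ 𝒜 ∈ I := by
  obtain ⟨-, hsing, hmono, -, -⟩ := hI
  have hempty : ∅ ∈ I :=
    hmono ∅ {fun _ => false} .empty (empty_subset _) (hsing _)
  let 𝒮 : Set (Set (Set Cantor)) :=
    {𝒜 | (∀ A ∈ 𝒜, MeasurableSet A ∧ A ∉ I ∧ P A) ∧ 𝒜.PairwiseDisjoint id}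
  obtain ⟨𝒜, h𝒜⟩ : ∃ 𝒜, Maximal (· ∈ 𝒮) 𝒜 := by
    refine zorn_subset 𝒮 fun c hc hchain => ⟨⋃₀ c, ⟨?_, ?_⟩, fun s hs => subset_sUnion_of_mem hs⟩
    · rintro A ⟨s, hs, hA⟩
      exact (hc hs).1 A hA
    · exact (pairwiseDisjoint_sUnion hchain.directedOn).2 fun s hs => (hc hs).2
  have hcount : 𝒜.Countable := by
    refine hccc 𝒜 (fun A hA => ⟨(h𝒜.prop.1 A hA).1, (h𝒜.prop.1 A hA).2.1⟩) ?_
    intro A hA A' hA' hne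
    exact (disjoint_iff_inter_eq_empty.1 (h𝒜.prop.2 hA hA' hne)) ▸ hempty
  refine ⟨𝒜, hcount, fun A hA => (h𝒜.prop.1 A hA).2.2, ?_⟩
  by_contra hpos
  obtain ⟨C, hCm, hCsub, hCI, hPC⟩ := hP _
    (hB.diff (.sUnion hcount fun A hA => (h𝒜.prop.1 A hA).1)) hpos sdiff_subset
  have hdisj : ∀ A ∈ 𝒜, Disjoint C A := fun A hA =>
    disjoint_left.2 fun r hrC hrA => (hCsub hrC).2 ⟨A, hA, hrA⟩
  have hinsert : insert C 𝒜 ∈ 𝒮 := by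
    refine ⟨?_, h𝒜.prop.2.insert fun A hA _ => hdisj A hA⟩
    rintro A (rfl | hA)
    · exact ⟨hCm, hCI, hPC⟩
    · exact h𝒜.prop.1 A hA
  have hC : C ∈ 𝒜 := h𝒜.le_of_ge hinsert (subset_insert C 𝒜) (mem_insert C 𝒜)
  exact hCI ((disjoint_self.1 (hdisj C hC)) ▸ hempty)

theorem exists_eventually_dominating (g : ℕ → ℕ → ℕ) :
    ∃ G : ℕ → ℕ, ∀ i n, i ≤ n → g i n ≤ G n :=
  ⟨fun n => (Finset.range (n + 1)).sup fun i => g i n, fun _ _ hin =>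
    Finset.le_sup (f := fun i => g i _) (Finset.mem_range.2 (Nat.lt_succ_of_le hin))⟩

theorem notMem_BSet_of_boundsSegments {a : ℕ → Set (List Bool)} {C : Set Cantor} {g G : ℕ → ℕ}
    {m : ℕ} (hC : BoundsSegments a C g) (hG : ∀ n, m ≤ n → g n ≤ G n) {r : Cantor} (hr : r ∈ C) :
    r ∉ BSet {s | ∃ n, s ∈ a n ∧ G n < s.length} := by
  refine not_infinite.2 (((finite_Iio m).biUnion fun n _ => finite_Iic (g n)).subset ?_)
  rintro k ⟨n, hk, hlen⟩
  rw [List.length_ofFn] at hlen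
  have hle := hC r hr n k hk
  refine mem_biUnion (x := n) ?_ hle
  by_contra hn
  exact absurd (hG n (not_lt.1 hn)) (by omega)

/-- If `I` is a ccc σ-ideal in which compact sets are dense and which admits
continuous reading of names, then `Î = {a : B_a ∈ I}` is a P-ideal. -/
theorem stmt0 (I : Set (Set Cantor)) (hI : SigmaIdeal I) (hccc : Ccc I)
    (hcd : CompactDense I) (hcrn : ContReading I)
    (a : ℕ → Set (List Bool)) (ha : ∀ n, BSet (a n) ∈ I) :
    ∃ b : Set (List Bool), BSet b ∈ I ∧ ∀ n, (a n \ b).Finite := by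
  have hN : MeasurableSet (⋃ n, BSet (a n)) := .iUnion fun n => measurableSet_BSet (a n)
  obtain ⟨𝒜, hcount, hbound, hcover⟩ := exists_countable_cover hI hccc hN.compl
    (P := fun C => ∃ g, BoundsSegments a C g) fun A hA hAI hAN => by
      obtain ⟨C, hC, hCA, hCI, hg⟩ := exists_boundsSegments hcrn hA hAI fun n =>
        (disjoint_compl_left.mono_left hAN).mono_right (subset_iUnion (fun n => BSet (a n)) n)
      exact ⟨C, hC.measurableSet, hCA, hCI, hg⟩
  obtain ⟨-, -, hmono, hunion, -⟩ := hI
  have hseq : ∃ g : ℕ → ℕ → ℕ, ∀ A ∈ 𝒜, ∃ i, BoundsSegments a A (g i) := by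
    rcases 𝒜.eq_empty_or_nonempty with rfl | hne
    · exact ⟨0, fun A hA => hA.elim⟩
    · obtain ⟨C, rfl⟩ := hcount.exists_eq_range hne
      choose g hg using fun i => hbound (C i) (mem_range_self i)
      exact ⟨g, forall_mem_range.2 fun i => ⟨i, hg i⟩⟩
  obtain ⟨g, hg⟩ := hseq
  obtain ⟨G, hG⟩ := exists_eventually_dominating g
  refine ⟨{s | ∃ n, s ∈ a n ∧ G n < s.length}, ?_, fun n => ?_⟩
  · refine hmono _ (⋃ i : ℕ, i.casesOn ((⋃ n, BSet (a n))ᶜ \ ⋃₀ 𝒜) fun n => BSet (a n))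
      (measurableSet_BSet _) (fun r hr => ?_) (hunion _ (by rintro (_ | n); exacts [hcover, ha n]))
    by_cases hrN : r ∈ ⋃ n, BSet (a n)
    · obtain ⟨n, hn⟩ := mem_iUnion.1 hrN
      exact mem_iUnion.2 ⟨n + 1, hn⟩
    · refine mem_iUnion.2 ⟨0, hrN, ?_⟩
      rintro ⟨A, hA, hrA⟩
      obtain ⟨i, hi⟩ := hg A hA
      exact notMem_BSet_of_boundsSegments hi (hG i) hrA hr
  · refine (List.finite_length_le Bool (G n)).subset ?_
    rintro s ⟨hs, hsb⟩
    exact not_lt.1 fun hlt => hsb ⟨n, hs, hlt⟩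
end

section
/- Let I be a σ-ideal on the Borel subsets of Cantor space 2^ℕ in which compact sets are dense and which admits continuous reading of names. Let (a_n) be a sequence of subsets of 2^{<ℕ} such that B_{a_n} ∈ I for every n, where B_a = { r ∈ 2^ℕ : r↾n ∈ a for infinitely many n }. Then for every I-positive Borel set A there is an I-positive compact set C ⊆ A such that for every n the set { s ∈ a_n : the cylinder [s] meets C } is finite. -/
open Set

/-- The cylinder `[s]` of all `r ∈ 2^ℕ` extending `s`. -/
def Cyl (s : List Bool) : Set Cantor :=
  {r | (List.ofFn fun i : Fin s.length => r i) = s}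

theorem SigmaIdeal.diff_iUnion_notMem {I : Set (Set Cantor)} (hI : SigmaIdeal I)
    {A : Set Cantor} (hA : MeasurableSet A) (hApos : A ∉ I)
    {B : ℕ → Set Cantor} (hB : ∀ n, B n ∈ I) : A \ ⋃ n, B n ∉ I := by
  obtain ⟨-, -, hmono, hunion, -⟩ := hI
  intro hD
  refine hApos (hmono A (⋃ n : ℕ, n.casesOn (A \ ⋃ n, B n) B) hA (fun x hx => ?_)
    (hunion _ fun n => ?_))
  · by_cases h : x ∈ ⋃ n, B n
    · obtain ⟨n, hn⟩ := mem_iUnion.1 h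
      exact mem_iUnion.2 ⟨n + 1, hn⟩
    · exact mem_iUnion.2 ⟨0, hx, h⟩
  · cases n with
    | zero => exact hD
    | succ n => exact hB n

/-- Off `BSet a`, a Borel function bounds the lengths of the restrictions lying in `a`. -/
theorem exists_measurable_bound (a : Set (List Bool)) (ha : MeasurableSet (BSet a)) :
    ∃ f : Cantor → ℕ, Measurable f ∧
      ∀ r ∉ BSet a, ∀ k, (List.ofFn fun i : Fin k => r i) ∈ a → k < f r := by
  classical
  let p : Cantor → ℕ → Prop := fun r N =>
    r ∈ BSet a ∨ ∀ k, N ≤ k → (List.ofFn fun i : Fin k => r i) ∉ a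
  have hp : ∀ r, ∃ N, p r N := by
    intro r
    by_cases hr : r ∈ BSet a
    · exact ⟨0, Or.inl hr⟩
    · obtain ⟨N, hN⟩ := (not_infinite.1 hr).bddAbove
      refine ⟨N + 1, Or.inr fun k hk hka => ?_⟩
      have : k ≤ N := hN hka
      omega
  refine ⟨fun r => Nat.find (hp r), measurable_find hp fun N => ?_, fun r hr k hk => ?_⟩
  · refine ha.union ?_
    have : {r : Cantor | ∀ k, N ≤ k → (List.ofFn fun i : Fin k => r i) ∉ a} =
        ⋂ k, ⋂ _ : N ≤ k, {r : Cantor | (List.ofFn fun i : Fin k => r i) ∈ a}ᶜ := by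
      ext r
      simp
    change MeasurableSet {r : Cantor | ∀ k, N ≤ k → (List.ofFn fun i : Fin k => r i) ∉ a}
    rw [this]
    exact MeasurableSet.iInter fun k => MeasurableSet.iInter fun _ =>
      (measurableSet_ofFn_mem a k).compl
  · by_contra! h
    exact (Nat.find_spec (hp r)).elim hr fun h' => h' k h hk

/-- If compact sets are dense in `I`, `I` admits continuous reading of names, and
`B_{a_n} ∈ I` for all `n`, then every `I`-positive Borel set `A` has an
`I`-positive compact subset `C` such that for each `n` only finitely many
`s ∈ a_n` have cylinders meeting `C`. -/
theorem stmt1 (I : Set (Set Cantor)) (hI : SigmaIdeal I)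
    (hcd : CompactDense I) (hcrn : ContReading I)
    (a : ℕ → Set (List Bool)) (ha : ∀ n, BSet (a n) ∈ I)
    (A : Set Cantor) (hA : MeasurableSet A) (hApos : A ∉ I) :
    ∃ C : Set Cantor, IsCompact C ∧ C ⊆ A ∧ C ∉ I ∧
      ∀ n, {s ∈ a n | (Cyl s ∩ C).Nonempty}.Finite := by
  choose f hfm hf using fun n => exists_measurable_bound (a n) (hI.1 _ (ha n))
  obtain ⟨C, hC, hCsub, hCpos, hcont⟩ := hcrn (A \ ⋃ n, BSet (a n))
    (hA.diff (MeasurableSet.iUnion fun n => hI.1 _ (ha n)))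
    (hI.diff_iUnion_notMem hA hApos ha) (fun r n => f n r)
    (measurable_pi_lambda _ hfm)
  refine ⟨C, hC, hCsub.trans sdiff_subset, hCpos, fun n => ?_⟩
  obtain ⟨N, hN⟩ := (hC.image_of_continuousOn
    ((continuous_apply n).comp_continuousOn hcont)).bddAbove
  refine (List.finite_length_lt Bool N).subset ?_
  rintro s ⟨hs, r, hrs, hrC⟩
  have hr : r ∉ BSet (a n) := fun h => (hCsub hrC).2 (mem_iUnion.2 ⟨n, h⟩)
  have hrs' : (List.ofFn fun i : Fin s.length => r i) = s := hrs
  exact (hf n r hr s.length (hrs'.symm ▸ hs)).trans_le (hN ⟨r, hrC, rfl⟩)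
end

section
/- Let I be a σ-ideal on the Borel subsets of Cantor space 2^ℕ which is ccc and in which compact sets are dense. Then I has a basis consisting of G_δ sets: for every Borel set A ∈ I there is a G_δ set G ∈ I with A ⊆ G. -/
open Set

/-- Every class `P` of sets contains a maximal pairwise disjoint family. -/
theorem exists_maximal_pairwiseDisjoint {X : Type*} (P : Set (Set X)) :
    ∃ 𝒜 : Set (Set X), Maximal (fun ℬ => ℬ ⊆ P ∧ ℬ.PairwiseDisjoint id) 𝒜 := by
  refine zorn_subset {ℬ | ℬ ⊆ P ∧ ℬ.PairwiseDisjoint id} fun c hc hchain => ?_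
  refine ⟨⋃₀ c, ⟨sUnion_subset fun ℬ hℬ => (hc hℬ).1, ?_⟩, fun ℬ hℬ => subset_sUnion_of_mem hℬ⟩
  exact (pairwise_sUnion hchain.directedOn).2 fun ℬ hℬ => (hc hℬ).2

/-- A nonempty member of `P` meets the union of any maximal pairwise disjoint subfamily of `P`. -/
theorem not_disjoint_sUnion_of_maximal {X : Type*} {P 𝒜 : Set (Set X)}
    (h𝒜 : Maximal (fun ℬ => ℬ ⊆ P ∧ ℬ.PairwiseDisjoint id) 𝒜) {C : Set X} (hC : C ∈ P)
    (hne : C.Nonempty) : ¬ Disjoint C (⋃₀ 𝒜) := by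
  intro hdisj
  have hmem : C ∈ 𝒜 := by
    refine h𝒜.le_of_ge ⟨insert_subset hC h𝒜.prop.1, h𝒜.prop.2.insert fun B hB _ => ?_⟩
      (subset_insert C 𝒜) (mem_insert C 𝒜)
    exact hdisj.mono_right (subset_sUnion_of_mem hB)
  exact hne.ne_empty (disjoint_self.1 (hdisj.mono_right (subset_sUnion_of_mem hmem)))

/-- A ccc σ-ideal in which compact sets are dense has a basis of `G_δ` sets:
every Borel set in `I` is covered by a `G_δ` set in `I`. -/
theorem stmt2 (I : Set (Set Cantor)) (hI : SigmaIdeal I) (hccc : Ccc I)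
    (hcd : CompactDense I) (A : Set Cantor) (hA : A ∈ I) :
    ∃ G : Set Cantor, IsGδ G ∧ G ∈ I ∧ A ⊆ G := by
  obtain ⟨hmeas, hsingle, hsub, hunion, -⟩ := hI
  have hempty : (∅ : Set Cantor) ∈ I :=
    hsub ∅ {fun _ => false} MeasurableSet.empty (empty_subset _) (hsingle _)
  obtain ⟨𝒜, h𝒜⟩ :=
    exists_maximal_pairwiseDisjoint {C : Set Cantor | IsCompact C ∧ C ⊆ Aᶜ ∧ C ∉ I}
  have hcount : 𝒜.Countable := by
    refine hccc 𝒜 (fun C hC => ?_) fun B hB C hC hBC => ?_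
    · exact ⟨(h𝒜.prop.1 hC).1.measurableSet, (h𝒜.prop.1 hC).2.2⟩
    · have hdisj : Disjoint B C := h𝒜.prop.2 hB hC hBC
      rwa [hdisj.inter_eq]
  have hG : IsGδ (⋃₀ 𝒜)ᶜ := by
    rw [compl_sUnion]
    refine IsGδ.sInter ?_ (hcount.image _)
    rintro _ ⟨C, hC, rfl⟩
    exact (h𝒜.prop.1 hC).1.isClosed.isOpen_compl.isGδ
  have hAG : A ⊆ (⋃₀ 𝒜)ᶜ :=
    subset_compl_comm.1 (sUnion_subset fun C hC => (h𝒜.prop.1 hC).2.1)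
  have hdiff : (⋃₀ 𝒜)ᶜ \ A ∈ I := by
    by_contra hpos
    obtain ⟨C, hCc, hCsub, hCI⟩ := hcd _ (hG.measurableSet.diff (hmeas A hA)) hpos
    refine not_disjoint_sUnion_of_maximal h𝒜 (C := C) ⟨hCc, fun x hx => (hCsub hx).2, hCI⟩ ?_ ?_
    · exact nonempty_iff_ne_empty.2 fun h => hCI (h ▸ hempty)
    · exact disjoint_left.2 fun x hx => (hCsub hx).1
  refine ⟨(⋃₀ 𝒜)ᶜ, hG, ?_, hAG⟩
  refine hsub _ _ hG.measurableSet (fun x hx => ?_)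
    (hunion (fun n => if n = 0 then A else (⋃₀ 𝒜)ᶜ \ A) fun n => ?_)
  · by_cases hxA : x ∈ A
    · exact mem_iUnion.2 ⟨0, by simpa using hxA⟩
    · exact mem_iUnion.2 ⟨1, by simpa using ⟨by simpa using hx, hxA⟩⟩
  · split_ifs
    exacts [hA, hdiff]
end

section
/- Let φ be a diffuse Maharam submeasure on the Borel subsets of Cantor space 2^ℕ. Then the following are equivalent: (1) φ dominates a nonzero finitely additive functional; (2) there is a φ-positive Borel set B such that φ restricted to B has a control measure, i.e. there is a finite Borel measure μ on 2^ℕ such that for every Borel set C ⊆ B, μ(C) = 0 if and only if φ(C) = 0. -/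
open Set Filter NNReal

/-- A submeasure on the Borel subsets of Cantor space: vanishes on `∅`, is
monotone and subadditive on Borel sets. -/
def Submeasure (φ : Set Cantor → ℝ≥0) : Prop :=
  φ ∅ = 0 ∧
  (∀ A B : Set Cantor, MeasurableSet A → MeasurableSet B → A ⊆ B → φ A ≤ φ B) ∧
  (∀ A B : Set Cantor, MeasurableSet A → MeasurableSet B → φ (A ∪ B) ≤ φ A + φ B)

/-- A Maharam (continuous) submeasure: a submeasure which is continuous along
decreasing sequences of Borel sets. -/
def Maharam (φ : Set Cantor → ℝ≥0) : Prop :=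
  Submeasure φ ∧
  ∀ A : ℕ → Set Cantor, (∀ n, MeasurableSet (A n)) → Antitone A →
    Tendsto (fun n => φ (A n)) atTop (nhds (φ (⋂ n, A n)))

/-- `φ` is diffuse: singletons are null. -/
def Diffuse (φ : Set Cantor → ℝ≥0) : Prop :=
  ∀ x : Cantor, φ ({x} : Set Cantor) = 0

/-- `ν` is a finitely additive functional on the Borel sets. -/
def FinAdd (ν : Set Cantor → ℝ≥0) : Prop :=
  ν ∅ = 0 ∧
  ∀ A B : Set Cantor, MeasurableSet A → MeasurableSet B → Disjoint A B →
    ν (A ∪ B) = ν A + ν B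

open MeasureTheory in
/-- A Maharam submeasure of the remainder of an increasing union tends to `0`. -/
theorem Maharam.tendsto_iUnion_diff {φ : Set Cantor → ℝ≥0} (hφ : Maharam φ)
    {A : ℕ → Set Cantor} (hA : ∀ n, MeasurableSet (A n)) (hmono : Monotone A) :
    Tendsto (fun n => φ ((⋃ k, A k) \ A n)) atTop (nhds 0) := by
  have h := hφ.2 (fun n => (⋃ k, A k) \ A n)
    (fun n => (MeasurableSet.iUnion hA).diff (hA n))
    (fun m n hmn => sdiff_subset_sdiff_right (hmono hmn))
  have he : (⋂ n, (⋃ k, A k) \ A n) = ∅ := by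
    rw [← sdiff_iUnion, sdiff_self]
  rwa [he, hφ.1.1] at h

/-- Exhaustion principle: a family of Borel sets closed under disjoint unions and increasing
countable unions has a member whose complement contains no `φ`-positive member. -/
theorem Maharam.exists_exhausting {φ : Set Cantor → ℝ≥0} (hφ : Maharam φ)
    {F : Set Cantor → Prop} (hF : ∀ A, F A → MeasurableSet A) (hF0 : F ∅)
    (hFu : ∀ A B, F A → F B → Disjoint A B → F (A ∪ B))
    (hFi : ∀ A : ℕ → Set Cantor, (∀ n, F (A n)) → Monotone A → F (⋃ n, A n)) :
    ∃ A, F A ∧ ∀ C, F C → Disjoint A C → φ C = 0 := by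
  have hstep : ∀ A, ∃ C, F C ∧ Disjoint A C ∧
      ∀ D, F D → Disjoint A D → φ D ≤ 2 * φ C := by
    intro A
    by_cases hpos : ∃ D, F D ∧ Disjoint A D ∧ φ D ≠ 0
    · obtain ⟨D₀, hD₀, hAD₀, hne⟩ := hpos
      let S : Set ℝ≥0 := {r | ∃ D, F D ∧ Disjoint A D ∧ φ D = r}
      have hbdd : BddAbove S := by
        refine ⟨φ univ, ?_⟩
        rintro _ ⟨D, hD, -, rfl⟩
        exact hφ.1.2.1 D univ (hF D hD) MeasurableSet.univ (subset_univ D)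
      have hSpos : 0 < sSup S :=
        (pos_iff_ne_zero.2 hne).trans_le (le_csSup hbdd ⟨D₀, hD₀, hAD₀, rfl⟩)
      obtain ⟨_, ⟨C, hC, hAC, rfl⟩, hlt⟩ :=
        exists_lt_of_lt_csSup (s := S) ⟨_, D₀, hD₀, hAD₀, rfl⟩ (NNReal.half_lt_self hSpos.ne')
      refine ⟨C, hC, hAC, fun D hD hAD => (le_csSup hbdd ⟨D, hD, hAD, rfl⟩).trans ?_⟩
      rw [div_lt_iff₀ (by norm_num)] at hlt
      rw [mul_comm]
      exact hlt.le
    · push Not at hpos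
      exact ⟨∅, hF0, disjoint_empty A, fun D hD hAD => by simp [hpos D hD hAD]⟩
  choose g hgF hgd hg using hstep
  let A : ℕ → Set Cantor := fun n => Nat.rec ∅ (fun _ B => B ∪ g B) n
  have hAs : ∀ n, A (n + 1) = A n ∪ g (A n) := fun n => rfl
  have hAF : ∀ n, F (A n) := by
    intro n
    induction n with
    | zero => exact hF0
    | succ n ih => exact hFu _ _ ih (hgF _) (hgd _)
  have hmono : Monotone A := monotone_nat_of_le_succ fun n => subset_union_left
  have hlim := hφ.tendsto_iUnion_diff (fun n => hF _ (hAF n)) hmono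
  refine ⟨⋃ n, A n, hFi A hAF hmono, fun C hC hdisj => ?_⟩
  have hle : ∀ n, φ C ≤ 2 * φ ((⋃ k, A k) \ A n) := by
    intro n
    refine (hg (A n) C hC (hdisj.mono_left (subset_iUnion A n))).trans ?_
    gcongr
    refine hφ.1.2.1 _ _ (hF _ (hgF _))
      ((MeasurableSet.iUnion fun k => hF _ (hAF k)).diff (hF _ (hAF n))) ?_
    refine subset_sdiff.2 ⟨?_, (hgd _).symm⟩
    exact (subset_union_right.trans (hAs n).ge).trans (subset_iUnion A (n + 1))
  have h0 := ge_of_tendsto' (hlim.const_mul 2) hle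
  simpa using h0

open MeasureTheory in
/-- A finite Borel measure is a Maharam submeasure. -/
theorem maharam_of_isFiniteMeasure (μ : Measure Cantor) [IsFiniteMeasure μ] :
    Maharam fun A => (μ A).toNNReal := by
  refine ⟨⟨by simp, fun A B _ _ hAB => ?_, fun A B _ _ => ?_⟩, fun A hA hanti => ?_⟩
  · exact ENNReal.toNNReal_mono (measure_ne_top μ B) (measure_mono hAB)
  · rw [← ENNReal.toNNReal_add (measure_ne_top μ A) (measure_ne_top μ B)]
    exact ENNReal.toNNReal_mono (by finiteness) (measure_union_le A B)
  · exact (ENNReal.tendsto_toNNReal (measure_ne_top μ _)).comp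
      (tendsto_measure_iInter_atTop (fun n => (hA n).nullMeasurableSet) hanti
        ⟨0, measure_ne_top μ _⟩)

open MeasureTheory in
/-- A finitely additive functional dominated by a Maharam submeasure is a measure. -/
theorem Maharam.exists_measure_of_finAdd {φ ν : Set Cantor → ℝ≥0} (hφ : Maharam φ)
    (hν : FinAdd ν) (hle : ∀ A, MeasurableSet A → ν A ≤ φ A) :
    ∃ μ : Measure Cantor, ∀ A, MeasurableSet A → μ A = ν A := by
  refine ⟨Measure.ofMeasurable (fun A _ => (ν A : ENNReal)) (by simp [hν.1]) ?_,
    fun A hA => Measure.ofMeasurable_apply A hA⟩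
  intro f hf hdisj
  let P : ℕ → Set Cantor := fun n => ⋃ i < n, f i
  have hPm : ∀ n, MeasurableSet (P n) := fun n =>
    MeasurableSet.biUnion (to_countable _) fun i _ => hf i
  have hPmono : Monotone P := fun m n hmn =>
    biUnion_subset_biUnion_left fun i (hi : i < m) => lt_of_lt_of_le hi hmn
  have hPU : ⋃ n, P n = ⋃ i, f i := by
    ext x
    simp only [P, mem_iUnion]
    exact ⟨fun ⟨_, i, _, hx⟩ => ⟨i, hx⟩, fun ⟨i, hx⟩ => ⟨i + 1, i, i.lt_succ_self, hx⟩⟩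
  have hPsum : ∀ n, ν (P n) = ∑ i ∈ Finset.range n, ν (f i) := by
    intro n
    induction n with
    | zero => simp [P, hν.1]
    | succ n ih =>
      have hPs : P (n + 1) = P n ∪ f n := biUnion_lt_succ f n
      rw [hPs, hν.2 _ _ (hPm n) (hf n), ih, Finset.sum_range_succ]
      exact disjoint_iUnion₂_left.2 fun i hi => hdisj hi.ne
  have hrest : Tendsto (fun n => ν ((⋃ i, f i) \ P n)) atTop (nhds 0) := by
    have h := hφ.tendsto_iUnion_diff hPm hPmono
    rw [hPU] at h
    exact tendsto_of_tendsto_of_tendsto_of_le_of_le tendsto_const_nhds h (fun _ => zero_le)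
      fun n => hle _ ((MeasurableSet.iUnion hf).diff (hPm n))
  have hsplit : ∀ n, ν (⋃ i, f i) =
      (∑ i ∈ Finset.range n, ν (f i)) + ν ((⋃ i, f i) \ P n) := by
    intro n
    rw [← hPsum, ← hν.2 _ _ (hPm n) ((MeasurableSet.iUnion hf).diff (hPm n)) disjoint_sdiff_right,
      union_sdiff_cancel (iUnion₂_subset fun i _ => subset_iUnion f i)]
  have hsum : Tendsto (fun n => ∑ i ∈ Finset.range n, (ν (f i) : ENNReal)) atTop
      (nhds (∑' i, (ν (f i) : ENNReal))) := ENNReal.tendsto_nat_tsum _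
  have hadd := hsum.add (ENNReal.tendsto_coe.2 hrest)
  have hconst : (fun n => (∑ i ∈ Finset.range n, (ν (f i) : ENNReal)) +
      (ν ((⋃ i, f i) \ P n) : ENNReal)) = fun _ => (ν (⋃ i, f i) : ENNReal) := by
    funext n
    rw [hsplit n]
    push_cast
    rfl
  rw [hconst] at hadd
  simpa using tendsto_nhds_unique tendsto_const_nhds hadd

open MeasureTheory in
/-- If `φ` dominates no nonzero finitely additive functional, then every finite measure `μ` is
carried by a set `A` with `φ A ≤ k * μ A`, for each `k > 0`. -/
theorem Maharam.exists_le_mul_measure {φ : Set Cantor → ℝ≥0} (hφ : Maharam φ)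
    (hno : ∀ ν : Set Cantor → ℝ≥0, FinAdd ν → (∀ A, MeasurableSet A → ν A ≤ φ A) → ν univ = 0)
    (μ : Measure Cantor) [IsFiniteMeasure μ] {k : ℝ≥0} (hk : 0 < k) :
    ∃ A, MeasurableSet A ∧ φ A ≤ k * (μ A).toNNReal ∧ μ Aᶜ = 0 := by
  have hμ := maharam_of_isFiniteMeasure μ
  have hadd : ∀ A B, MeasurableSet B → Disjoint A B →
      (μ (A ∪ B)).toNNReal = (μ A).toNNReal + (μ B).toNNReal := fun A B hB hd => by
    rw [measure_union hd hB, ENNReal.toNNReal_add (measure_ne_top μ A) (measure_ne_top μ B)]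
  obtain ⟨A, ⟨hA, hAle⟩, hmax⟩ := hμ.exists_exhausting
    (F := fun A => MeasurableSet A ∧ φ A ≤ k * (μ A).toNNReal) (fun A h => h.1)
    ⟨MeasurableSet.empty, by simp [hφ.1.1]⟩
    (fun A B hA hB hd => ⟨hA.1.union hB.1, by
      rw [hadd A B hB.1 hd, mul_add]
      exact (hφ.1.2.2 A B hA.1 hB.1).trans (add_le_add hA.2 hB.2)⟩)
    (fun A hA hmono => by
      have hm := MeasurableSet.iUnion fun n => (hA n).1
      refine ⟨hm, ?_⟩
      have hlim := (hφ.tendsto_iUnion_diff (fun n => (hA n).1) hmono).const_add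
        (k * (μ (⋃ n, A n)).toNNReal)
      rw [add_zero] at hlim
      refine ge_of_tendsto' hlim fun n => ?_
      calc φ (⋃ n, A n) = φ (A n ∪ (⋃ n, A n) \ A n) := by
            rw [union_sdiff_cancel (subset_iUnion A n)]
        _ ≤ φ (A n) + φ ((⋃ n, A n) \ A n) := hφ.1.2.2 _ _ (hA n).1 (hm.diff (hA n).1)
        _ ≤ k * (μ (⋃ n, A n)).toNNReal + φ ((⋃ n, A n) \ A n) := by
            gcongr
            exact (hA n).2.trans (mul_le_mul_right
              (hμ.1.2.1 _ _ (hA n).1 hm (subset_iUnion A n)) k))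
  refine ⟨A, hA, hAle, ?_⟩
  have h0 := hno (fun C => k * (μ (C ∩ Aᶜ)).toNNReal)
    ⟨by simp, fun C D _ hD hd => by
      beta_reduce
      rw [union_inter_distrib_right, hadd _ _ (hD.inter hA.compl)
        (hd.mono inter_subset_left inter_subset_left), mul_add]⟩ ?_
  · simpa [hk.ne', ENNReal.toNNReal_eq_zero_iff] using h0
  · intro C hC
    by_contra! hlt
    have hCm := hC.inter hA.compl
    have hCφ := (hφ.1.2.1 _ _ hCm hC inter_subset_left).trans hlt.le
    have := hmax (C ∩ Aᶜ) ⟨hCm, hCφ⟩ (disjoint_compl_right.mono_right inter_subset_right)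
    simp [this] at hlt

/-- For a diffuse Maharam submeasure `φ`, `φ` dominates a nonzero finitely
additive functional iff some `φ`-positive Borel set `B` carries a control
measure for the restriction of `φ` to `B`. -/
theorem stmt3 (φ : Set Cantor → ℝ≥0) (hφ : Maharam φ) (hd : Diffuse φ) :
    (∃ ν : Set Cantor → ℝ≥0, FinAdd ν ∧ (∀ A : Set Cantor, MeasurableSet A → ν A ≤ φ A) ∧
      0 < ν univ) ↔
    (∃ B : Set Cantor, MeasurableSet B ∧ φ B ≠ 0 ∧
      ∃ μ : MeasureTheory.Measure Cantor, MeasureTheory.IsFiniteMeasure μ ∧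
        ∀ C : Set Cantor, MeasurableSet C → C ⊆ B → (μ C = 0 ↔ φ C = 0)) := by
  constructor
  · rintro ⟨ν, hν, hle, hpos⟩
    obtain ⟨μ, hμ⟩ := hφ.exists_measure_of_finAdd hν hle
    obtain ⟨N, ⟨hN, hN0⟩, hmax⟩ := hφ.exists_exhausting
      (F := fun A => MeasurableSet A ∧ μ A = 0) (fun A h => h.1) ⟨MeasurableSet.empty, by simp⟩
      (fun A B hA hB _ => ⟨hA.1.union hB.1, MeasureTheory.measure_union_null hA.2 hB.2⟩)
      (fun A hA _ => ⟨MeasurableSet.iUnion fun n => (hA n).1,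
        MeasureTheory.measure_iUnion_null fun n => (hA n).2⟩)
    have hnull : ∀ C, MeasurableSet C → φ C = 0 → μ C = 0 := fun C hC h => by
      have := hle C hC
      rw [h, nonpos_iff_eq_zero] at this
      rw [hμ C hC, this, ENNReal.coe_zero]
    refine ⟨Nᶜ, hN.compl, fun h => ?_, μ, ⟨?_⟩, fun C hC hCN => ⟨fun h => ?_, hnull C hC⟩⟩
    · have huniv : μ univ = 0 := by
        rw [← union_compl_self N]
        exact MeasureTheory.measure_union_null hN0 (hnull _ hN.compl h)
      rw [hμ univ MeasurableSet.univ, ENNReal.coe_eq_zero] at huniv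
      exact hpos.ne' huniv
    · rw [hμ univ MeasurableSet.univ]
      exact ENNReal.coe_lt_top
    · exact hmax C ⟨hC, h⟩ (disjoint_compl_right.mono_right hCN)
  · rintro ⟨B, hB, hφB, μ, hμfin, hμ⟩
    by_contra! hno
    have hex : ∀ n : ℕ, ∃ A, MeasurableSet A ∧
        φ A ≤ (1 / ((n : ℝ≥0) + 1)) * (μ A).toNNReal ∧ μ Aᶜ = 0 := fun n =>
      hφ.exists_le_mul_measure (fun ν h₁ h₂ => nonpos_iff_eq_zero.1 (hno ν h₁ h₂)) μ (by positivity)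
    choose A hA hAle hAc using hex
    have hN : MeasurableSet (⋂ n, A n) := MeasurableSet.iInter hA
    have hN0 : φ (⋂ n, A n) = 0 := by
      have hlim : Tendsto (fun n : ℕ => (1 / ((n : ℝ≥0) + 1)) * (μ univ).toNNReal) atTop
          (nhds 0) := by
        simpa using (tendsto_one_div_add_atTop_nhds_zero_nat (𝕜 := ℝ≥0)).mul_const
          (μ univ).toNNReal
      refine nonpos_iff_eq_zero.1 (ge_of_tendsto' hlim fun n => ?_)
      refine ((hφ.1.2.1 _ _ hN (hA n) (iInter_subset A n)).trans (hAle n)).trans ?_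
      gcongr
      · exact MeasureTheory.measure_ne_top μ univ
      · exact subset_univ _
    have hNc : μ (⋂ n, A n)ᶜ = 0 := by
      rw [compl_iInter]
      exact MeasureTheory.measure_iUnion_null hAc
    have hBN : μ (B ∩ ⋂ n, A n) = 0 := by
      refine (hμ _ (hB.inter hN) inter_subset_left).2 (nonpos_iff_eq_zero.1 ?_)
      exact (hφ.1.2.1 _ _ (hB.inter hN) hN inter_subset_right).trans hN0.le
    refine hφB ((hμ B hB Subset.rfl).1 ?_)
    rw [← inter_union_compl B (⋂ n, A n)]
    exact MeasureTheory.measure_union_null hBN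
      (MeasureTheory.measure_mono_null inter_subset_right hNc)
end

section
/- Let φ be a Maharam submeasure on the Borel subsets of Cantor space 2^ℕ and let ν be a nonzero finitely additive functional dominated by φ. Then there is a φ-positive Borel set B such that ν(C) > 0 for every φ-positive Borel set C ⊆ B. -/
open Set Filter NNReal

/-- Among the `ν`-null Borel sets disjoint from `D` there is one whose `φ`-value is
at least half of every other. -/
theorem exists_null_disjoint_half_maximal {φ ν : Set Cantor → ℝ≥0} (hφ : Submeasure φ)
    (hν : ν ∅ = 0) (D : Set Cantor) :
    ∃ C, MeasurableSet C ∧ Disjoint C D ∧ ν C = 0 ∧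
      ∀ C', MeasurableSet C' → Disjoint C' D → ν C' = 0 → φ C' ≤ 2 * φ C := by
  by_contra! h
  -- Otherwise the `φ`-values of such sets could be doubled indefinitely.
  have step : ∀ n : ℕ, ∃ C, MeasurableSet C ∧ Disjoint C D ∧ ν C = 0 ∧ (n : ℝ≥0) < φ C := by
    obtain ⟨C₀, hm₀, hd₀, hn₀, h₀⟩ := h ∅ .empty (empty_disjoint D) hν
    have grow : ∀ n : ℕ, ∃ C, MeasurableSet C ∧ Disjoint C D ∧ ν C = 0 ∧
        (2 : ℝ≥0) ^ n * φ C₀ ≤ φ C := by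
      intro n
      induction n with
      | zero => exact ⟨C₀, hm₀, hd₀, hn₀, by simp⟩
      | succ n ih =>
        obtain ⟨C, hm, hd, hn, hC⟩ := ih
        obtain ⟨C', hm', hd', hn', hC'⟩ := h C hm hd hn
        refine ⟨C', hm', hd', hn', le_trans ?_ hC'.le⟩
        rw [pow_succ', mul_assoc]
        gcongr
    have hpos : 0 < φ C₀ := pos_of_gt h₀
    intro n
    obtain ⟨k, hk⟩ := pow_unbounded_of_one_lt ((n : ℝ≥0) / φ C₀) one_lt_two
    obtain ⟨C, hm, hd, hn, hC⟩ := grow k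
    exact ⟨C, hm, hd, hn, ((div_lt_iff₀ hpos).1 hk).trans_le hC⟩
  obtain ⟨n, hn⟩ := exists_nat_gt (φ univ)
  obtain ⟨C, hm, -, -, hC⟩ := step n
  exact absurd (hφ.2.1 C univ hm .univ (subset_univ C)) (hn.trans hC).not_ge

/-- If `ν` is a nonzero finitely additive functional dominated by a Maharam
submeasure `φ`, then there is a `φ`-positive Borel set `B` on which `ν` is
positive on every `φ`-positive Borel subset. -/
theorem stmt4 (φ ν : Set Cantor → ℝ≥0) (hφ : Maharam φ) (hν : FinAdd ν)
    (hdom : ∀ A : Set Cantor, MeasurableSet A → ν A ≤ φ A) (hpos : 0 < ν univ) :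
    ∃ B : Set Cantor, MeasurableSet B ∧ φ B ≠ 0 ∧
      ∀ C : Set Cantor, MeasurableSet C → C ⊆ B → φ C ≠ 0 → 0 < ν C := by
  choose f hfm hfd hfν hfmax using exists_null_disjoint_half_maximal hφ.1 hν.1
  let D : ℕ → Set Cantor := fun n => Nat.rec ∅ (fun _ D => D ∪ f D) n
  have hDsucc : ∀ n, D (n + 1) = D n ∪ f (D n) := fun _ => rfl
  have hDm : ∀ n, MeasurableSet (D n) := by
    intro n
    induction n with
    | zero => exact .empty
    | succ n ih => exact ih.union (hfm _)
  have hDν : ∀ n, ν (D n) = 0 := by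
    intro n
    induction n with
    | zero => exact hν.1
    | succ n ih =>
      rw [hDsucc, hν.2 _ _ (hDm n) (hfm _) (hfd _).symm, ih, hfν, add_zero]
  have hDmono : Monotone D := monotone_nat_of_le_succ fun n => subset_union_left
  set U := ⋃ n, D n with hU
  have hUm : MeasurableSet U := .iUnion hDm
  have htail : Tendsto (fun n => φ (U \ D n)) atTop (nhds 0) := by
    have h := hφ.2 (fun n => U \ D n) (fun n => hUm.diff (hDm n))
      fun _ _ hmn => sdiff_subset_sdiff_right (hDmono hmn)
    rwa [← sdiff_iUnion, ← hU, sdiff_self, hφ.1.1] at h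
  have hUν : ν U = 0 := by
    refine le_antisymm (ge_of_tendsto' htail fun n => ?_) zero_le
    calc ν U = ν (D n ∪ U \ D n) := by rw [union_sdiff_cancel (subset_iUnion D n)]
      _ = ν (U \ D n) := by
        rw [hν.2 _ _ (hDm n) (hUm.diff (hDm n)) disjoint_sdiff_right, hDν, zero_add]
      _ ≤ φ (U \ D n) := hdom _ (hUm.diff (hDm n))
  refine ⟨Uᶜ, hUm.compl, fun h => hpos.ne' ?_, fun C hCm hCU hC => ?_⟩
  · rw [← union_compl_self U, hν.2 _ _ hUm hUm.compl disjoint_compl_right, hUν, zero_add]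
    exact le_antisymm (h ▸ hdom _ hUm.compl) zero_le
  · refine pos_iff_ne_zero.2 fun hCν => hC (le_antisymm ?_ zero_le)
    have hlim := htail.const_mul 2
    rw [mul_zero] at hlim
    refine ge_of_tendsto' hlim fun n => ?_
    have hCD : Disjoint C (D n) :=
      disjoint_left.2 fun x hx hxD => hCU hx (mem_iUnion.2 ⟨n, hxD⟩)
    have hfU : f (D n) ⊆ U \ D n := fun x hx =>
      ⟨mem_iUnion.2 ⟨n + 1, Or.inr hx⟩, disjoint_left.1 (hfd (D n)) hx⟩
    exact (hfmax _ C hCm hCD hCν).trans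
      (mul_le_mul_right (hφ.1.2.1 _ _ (hfm _) (hUm.diff (hDm n)) hfU) 2)
end

section
/- Let φ be a diffuse Maharam submeasure on the Borel subsets of Cantor space 2^ℕ and let μ denote Lebesgue measure on [0,1]. Then exactly one of the following holds: (1) there is a φ-positive Borel set B such that φ restricted to B has a control measure, i.e. a finite Borel measure λ with λ(C) = 0 if and only if φ(C) = 0 for every Borel C ⊆ B; (2) there is a Borel set C ⊆ [0,1] × 2^ℕ such that φ(C_x) = 0 for every x ∈ [0,1] and μ([0,1] ∖ C^y) = 0 for every y ∈ 2^ℕ, where C_x = {y : (x,y) ∈ C} and C^y = {x : (x,y) ∈ C}. -/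
open Set Filter NNReal

open MeasureTheory

namespace Maharam

variable {φ : Set Cantor → ℝ≥0}

theorem map_empty (hφ : Maharam φ) : φ ∅ = 0 := hφ.1.1

theorem mono (hφ : Maharam φ) {A B : Set Cantor} (hA : MeasurableSet A) (hB : MeasurableSet B)
    (h : A ⊆ B) : φ A ≤ φ B := hφ.1.2.1 A B hA hB h

theorem union_le (hφ : Maharam φ) {A B : Set Cantor} (hA : MeasurableSet A)
    (hB : MeasurableSet B) : φ (A ∪ B) ≤ φ A + φ B := hφ.1.2.2 A B hA hB

theorem le_of_subset_union (hφ : Maharam φ) {A B C : Set Cantor} (hA : MeasurableSet A)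
    (hB : MeasurableSet B) (hC : MeasurableSet C) (h : A ⊆ B ∪ C) : φ A ≤ φ B + φ C :=
  (hφ.mono hA (hB.union hC) h).trans (hφ.union_le hB hC)

theorem tendsto_iUnion_diff_s7 (hφ : Maharam φ) {A : ℕ → Set Cantor} (hA : ∀ n, MeasurableSet (A n))
    (hmono : Monotone A) : Tendsto (fun n => φ ((⋃ k, A k) \ A n)) atTop (nhds 0) := by
  have h := hφ.2 (fun n => (⋃ k, A k) \ A n) (fun n => (MeasurableSet.iUnion hA).diff (hA n))
    fun m n hmn => sdiff_subset_sdiff_right (hmono hmn)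
  have he : ⋂ n, (⋃ k, A k) \ A n = ∅ := by
    rw [← sdiff_iUnion, sdiff_self]
  rwa [he, hφ.map_empty] at h

theorem tendsto_zero_of_pairwise_disjoint (hφ : Maharam φ) {A : ℕ → Set Cantor}
    (hA : ∀ n, MeasurableSet (A n)) (hd : Pairwise (Function.onFun Disjoint A)) :
    Tendsto (fun n => φ (A n)) atTop (nhds 0) := by
  have hm : ∀ n, MeasurableSet (⋃ k ≥ n, A k) :=
    fun n => MeasurableSet.iUnion fun k => MeasurableSet.iUnion fun _ => hA k
  have h := hφ.2 (fun n => ⋃ k ≥ n, A k) hm fun m n hmn =>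
    iUnion_mono fun k => iUnion_mono' fun hk => ⟨hmn.trans hk, subset_rfl⟩
  have he : ⋂ n, ⋃ k ≥ n, A k = ∅ := by
    refine eq_empty_of_forall_notMem fun x hx => ?_
    simp only [mem_iInter, mem_iUnion] at hx
    obtain ⟨k, -, hk⟩ := hx 0
    obtain ⟨l, hl, hxl⟩ := hx (k + 1)
    exact disjoint_left.1 (hd (by omega : k ≠ l)) hk hxl
  rw [he, hφ.map_empty] at h
  exact tendsto_of_tendsto_of_tendsto_of_le_of_le tendsto_const_nhds h (fun _ => zero_le)
    fun n => hφ.mono (hA n) (hm n) (subset_iUnion₂_of_subset n le_rfl subset_rfl)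

theorem iUnion_null (hφ : Maharam φ) {A : ℕ → Set Cantor} (hA : ∀ n, MeasurableSet (A n))
    (h0 : ∀ n, φ (A n) = 0) : φ (⋃ n, A n) = 0 := by
  have hm : ∀ n, MeasurableSet (accumulate A n) := fun n => .iUnion fun k => .iUnion fun _ => hA k
  have hacc : ∀ n, φ (accumulate A n) = 0 := by
    intro n
    induction n with
    | zero => simpa using h0 0
    | succ n ih =>
      rw [accumulate_succ]
      refine le_antisymm ((hφ.union_le (hm n) (hA _)).trans ?_) zero_le
      rw [ih, h0, add_zero]
  have h := hφ.tendsto_iUnion_diff_s7 hm monotone_accumulate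
  rw [iUnion_accumulate] at h
  refine le_antisymm (ge_of_tendsto' h fun n => ?_) zero_le
  have := hφ.le_of_subset_union (MeasurableSet.iUnion hA) (hm n)
    ((MeasurableSet.iUnion hA).diff (hm n)) (by rw [union_sdiff_self]; exact subset_union_right)
  rwa [hacc, zero_add] at this

/-- A σ-ideal of Borel sets has a largest element modulo `φ`-null sets. -/
theorem exists_null_of_disjoint (hφ : Maharam φ) {P : Set Cantor → Prop} (h0 : P ∅)
    (hP : ∀ A : ℕ → Set Cantor, (∀ n, MeasurableSet (A n)) → (∀ n, P (A n)) → P (⋃ n, A n)) :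
    ∃ Z, MeasurableSet Z ∧ P Z ∧ ∀ C, MeasurableSet C → P C → Disjoint C Z → φ C = 0 := by
  have step : ∀ Z : Set Cantor, ∃ C, MeasurableSet C ∧ P C ∧ Disjoint C Z ∧
      ∀ D, MeasurableSet D → P D → Disjoint D Z → φ D ≤ 2 * φ C := by
    intro Z
    set S : Set ℝ≥0 := φ '' {C | MeasurableSet C ∧ P C ∧ Disjoint C Z} with hS
    have hbdd : BddAbove S := ⟨φ univ, by
      rintro _ ⟨C, hC, rfl⟩
      exact hφ.mono hC.1 .univ (subset_univ C)⟩
    have hle : ∀ D, MeasurableSet D → P D → Disjoint D Z → φ D ≤ sSup S :=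
      fun D h₁ h₂ h₃ => le_csSup hbdd ⟨D, ⟨h₁, h₂, h₃⟩, rfl⟩
    have hne : S.Nonempty := ⟨_, ∅, ⟨.empty, h0, empty_disjoint Z⟩, rfl⟩
    rcases eq_or_ne (sSup S) 0 with hs | hs
    · exact ⟨∅, .empty, h0, empty_disjoint Z, fun D h₁ h₂ h₃ =>
        ((hle D h₁ h₂ h₃).trans hs.le).trans zero_le⟩
    · obtain ⟨_, ⟨C, hC, rfl⟩, hlt⟩ := exists_lt_of_lt_csSup hne (NNReal.half_lt_self hs)
      refine ⟨C, hC.1, hC.2.1, hC.2.2, fun D h₁ h₂ h₃ => (hle D h₁ h₂ h₃).trans ?_⟩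
      rw [div_lt_iff₀ two_pos] at hlt
      rw [mul_comm]
      exact hlt.le
  choose c hcm hcP hcd hc using step
  let Z : ℕ → Set Cantor := fun n => Nat.rec ∅ (fun _ Y => Y ∪ c Y) n
  have hsub : ∀ n, c (Z n) ⊆ Z (n + 1) := fun n => subset_union_right
  have hmono : Monotone Z := monotone_nat_of_le_succ fun n => subset_union_left
  have hZ : ⋃ n, c (Z n) = ⋃ n, Z n := by
    refine subset_antisymm (iUnion_mono' fun n => ⟨n + 1, hsub n⟩) (iUnion_subset fun n => ?_)
    induction n with
    | zero => exact empty_subset _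
    | succ n ih => exact union_subset ih (subset_iUnion (fun n => c (Z n)) n)
  have hdisj : Pairwise (Function.onFun Disjoint fun n => c (Z n)) := by
    refine (pairwise_disjoint_on _).2 fun m n hmn => ?_
    exact ((hcd (Z n)).mono_right ((hsub m).trans (hmono hmn))).symm
  have hlim := hφ.tendsto_zero_of_pairwise_disjoint (fun n => hcm (Z n)) hdisj
  refine ⟨⋃ n, c (Z n), .iUnion fun n => hcm _, hP _ (fun n => hcm _) fun n => hcP _,
    fun C hC hPC hCZ => ?_⟩
  have h2 : Tendsto (fun n => 2 * φ (c (Z n))) atTop (nhds 0) := by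
    simpa using hlim.const_mul 2
  refine le_antisymm (ge_of_tendsto' h2 fun n => hc (Z n) C hC hPC ?_) zero_le
  rw [hZ] at hCZ
  exact hCZ.mono_right (subset_iUnion Z n)

theorem add {ψ : Set Cantor → ℝ≥0} (hφ : Maharam φ) (hψ : Maharam ψ) :
    Maharam fun A => φ A + ψ A := by
  refine ⟨⟨by simp [hφ.map_empty, hψ.map_empty], fun A B hA hB h =>
    add_le_add (hφ.mono hA hB h) (hψ.mono hA hB h), fun A B hA hB => ?_⟩, fun A hA h =>
    (hφ.2 A hA h).add (hψ.2 A hA h)⟩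
  exact (add_le_add (hφ.union_le hA hB) (hψ.union_le hA hB)).trans (by rw [add_add_add_comm])

theorem of_measure (lam : Measure Cantor) [IsFiniteMeasure lam] :
    Maharam fun A => (lam A).toNNReal := by
  refine ⟨⟨by simp, fun A B _ _ h => ENNReal.toNNReal_mono (measure_ne_top _ _)
    (measure_mono h), fun A B _ _ => ?_⟩, fun A hA h => ?_⟩
  · rw [← ENNReal.toNNReal_add (measure_ne_top _ _) (measure_ne_top _ _)]
    exact ENNReal.toNNReal_mono (by finiteness) (measure_union_le A B)
  · exact (ENNReal.tendsto_toNNReal (measure_ne_top _ _)).comp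
      (tendsto_measure_iInter_atTop (fun n => (hA n).nullMeasurableSet) h ⟨0, measure_ne_top _ _⟩)

theorem exists_isClopen_symmDiff_lt (hφ : Maharam φ) {A : Set Cantor} (hA : MeasurableSet A)
    {δ : ℝ≥0} (hδ : 0 < δ) : ∃ K, IsClopen K ∧ φ (symmDiff A K) < δ := by
  let Q : Set Cantor → Prop := fun A => MeasurableSet A ∧
    ∀ δ : ℝ≥0, 0 < δ → ∃ K, IsClopen K ∧ φ (symmDiff A K) < δ
  have hQe : Q ∅ := ⟨.empty, fun δ hδ => ⟨∅, isClopen_empty, by simpa [hφ.map_empty] using hδ⟩⟩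
  have hQu : ∀ A B, Q A → Q B → Q (A ∪ B) := by
    rintro A B ⟨hA, hA'⟩ ⟨hB, hB'⟩
    refine ⟨hA.union hB, fun δ hδ => ?_⟩
    obtain ⟨K, hK, hAK⟩ := hA' (δ / 2) (half_pos hδ)
    obtain ⟨L, hL, hBL⟩ := hB' (δ / 2) (half_pos hδ)
    refine ⟨K ∪ L, hK.union hL, lt_of_le_of_lt (hφ.le_of_subset_union
      ((hA.union hB).symmDiff (hK.union hL).isOpen.measurableSet) (hA.symmDiff hK.isOpen.measurableSet)
      (hB.symmDiff hL.isOpen.measurableSet) ?_) ((add_lt_add hAK hBL).trans_eq (add_halves δ))⟩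
    intro x
    simp only [mem_symmDiff, mem_union]
    tauto
  suffices h : Q A from h.2 δ hδ
  have hb : (inferInstance : MeasurableSpace Cantor) =
      MeasurableSpace.generateFrom {K : Set Cantor | IsClopen K} := by
    rw [← (isTopologicalBasis_isClopen (X := Cantor)).borel_eq_generateFrom]
    exact BorelSpace.measurable_eq
  induction A, hA using MeasurableSpace.induction_on_inter hb
    (fun A hA B hB _ => hA.inter hB) with
  | empty => exact hQe
  | basic A hA =>
    exact ⟨hA.isOpen.measurableSet, fun δ hδ => ⟨A, hA, by simpa [hφ.map_empty] using hδ⟩⟩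
  | compl A hA ih =>
    refine ⟨hA.compl, fun δ hδ => ?_⟩
    obtain ⟨K, hK, h⟩ := ih.2 δ hδ
    exact ⟨Kᶜ, hK.compl, by rwa [compl_symmDiff_compl]⟩
  | iUnion A _ hA ih =>
    refine ⟨.iUnion hA, fun δ hδ => ?_⟩
    have hacc : ∀ n, Q (accumulate A n) := by
      intro n
      induction n with
      | zero => simpa using ih 0
      | succ n ihn =>
        rw [accumulate_succ]
        exact hQu _ _ ihn (ih _)
    have h := hφ.tendsto_iUnion_diff_s7 (fun n => (hacc n).1) monotone_accumulate
    rw [iUnion_accumulate] at h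
    obtain ⟨n, hn⟩ := (h.eventually_lt_const (half_pos hδ)).exists
    obtain ⟨K, hK, hAK⟩ := (hacc n).2 (δ / 2) (half_pos hδ)
    have hU := MeasurableSet.iUnion hA
    refine ⟨K, hK, lt_of_le_of_lt (hφ.le_of_subset_union (hU.symmDiff hK.isOpen.measurableSet)
      (hU.diff (hacc n).1) ((hacc n).1.symmDiff hK.isOpen.measurableSet) ?_)
      ((add_lt_add hn hAK).trans_eq (add_halves δ))⟩
    intro x hx
    have hs : accumulate A n ⊆ ⋃ k, A k := accumulate_subset_iUnion n
    have := @hs x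
    simp only [mem_symmDiff, mem_union, Set.mem_sdiff] at hx ⊢
    tauto

/-- If no `φ`-null set has full `lam`-measure, then `lam` restricts to a control measure for `φ` on
some positive set. -/
theorem exists_control_measure (hφ : Maharam φ) (lam : Measure Cantor) [IsFiniteMeasure lam]
    (h : ∀ A, MeasurableSet A → φ A = 0 → lam A ≠ lam univ) :
    ∃ B : Set Cantor, MeasurableSet B ∧ φ B ≠ 0 ∧ ∃ ν : Measure Cantor, IsFiniteMeasure ν ∧
      ∀ C : Set Cantor, MeasurableSet C → C ⊆ B → (ν C = 0 ↔ φ C = 0) := by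
  obtain ⟨N, hN, hφN, hmax⟩ := (of_measure lam).exists_null_of_disjoint (P := fun A => φ A = 0)
    hφ.map_empty fun A hA h0 => hφ.iUnion_null hA h0
  have hlamN : lam Nᶜ ≠ 0 := fun h0 => h N hN hφN
    (measure_eq_measure_of_null_sdiff (subset_univ N) (by rwa [← compl_eq_univ_sdiff]))
  set ν := lam.restrict Nᶜ with hν
  have hac : ∀ C, MeasurableSet C → φ C = 0 → ν C = 0 := by
    intro C hC h0
    have hm := hC.inter hN.compl
    have h1 := hmax (C ∩ Nᶜ) hm
      (le_antisymm ((hφ.mono hm hC inter_subset_left).trans h0.le) zero_le)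
      (disjoint_compl_left.mono_left inter_subset_right)
    rw [hν, Measure.restrict_apply hC]
    exact ((ENNReal.toNNReal_eq_zero_iff _).1 h1).resolve_right (measure_ne_top _ _)
  obtain ⟨Z, hZ, hνZ, hZmax⟩ := hφ.exists_null_of_disjoint (P := fun A => ν A = 0)
    measure_empty fun A _ h0 => measure_iUnion_null h0
  refine ⟨Zᶜ, hZ.compl, fun h0 => hlamN ?_, ν, inferInstance, fun C hC hCZ =>
    ⟨fun h0 => hZmax C hC h0 (disjoint_left.2 fun x hx => hCZ hx), hac C hC⟩⟩
  have hu : ν univ = 0 := by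
    rw [← union_compl_self Z]
    exact measure_union_null hνZ (hac _ hZ.compl h0)
  rwa [hν, Measure.restrict_apply_univ] at hu

end Maharam

/-- Separation of the convex hull of the indicators of a family of clopen sets from the functions
bounded below by `c`. -/
theorem exists_measure_real_le_mul {S : Set (Set Cantor)} (hS : ∀ K ∈ S, IsClopen K)
    (h0 : ∅ ∈ S) {c : ℝ} (hc1 : c < 1)
    (h : ∀ f ∈ convexHull ℝ {f : C(Cantor, ℝ) | ∃ K ∈ S, ⇑f = K.indicator 1}, ∃ y, f y ≤ c) :
    ∃ lam : Measure Cantor, IsFiniteMeasure lam ∧ 0 < lam.real univ ∧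
      ∀ K ∈ S, lam.real K ≤ c * lam.real univ := by
  set T := {f : C(Cantor, ℝ) | ∃ K ∈ S, ⇑f = K.indicator 1} with hT
  let U : Set C(Cantor, ℝ) := {f | MapsTo f univ (Ioi c)}
  have hUo : IsOpen U := ContinuousMap.isOpen_setOfPred_mapsTo isCompact_univ isOpen_Ioi
  have hUc : Convex ℝ U := fun f hf g hg a b ha hb hab y hy =>
    convex_Ioi c (hf hy) (hg hy) ha hb hab
  have hd : Disjoint U (convexHull ℝ T) := disjoint_left.2 fun f hf hfT => by
    obtain ⟨y, hy⟩ := h f hfT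
    exact not_lt_of_ge hy (hf (mem_univ y))
  obtain ⟨F, u, hFU, hFT⟩ := geometric_hahn_banach_open hUc hUo (convex_convexHull ℝ T) hd
  have hu0 : u ≤ 0 := by
    have := hFT 0 (subset_convexHull ℝ T ⟨∅, h0, by rw [indicator_empty]; rfl⟩)
    rwa [map_zero] at this
  have h1U : (1 : C(Cantor, ℝ)) ∈ U := fun y _ => hc1
  have hF1 : F 1 < u := hFU 1 h1U
  have hneg : ∀ g : C(Cantor, ℝ), 0 ≤ g → F g ≤ 0 := by
    intro g hg
    by_contra! hpos
    have ht : 0 ≤ (u - F 1) / F g := div_nonneg (by linarith) hpos.le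
    have := hFU (1 + ((u - F 1) / F g) • g) fun y _ => by
      have hy : 0 ≤ ((u - F 1) / F g) * g y := mul_nonneg ht (hg y)
      simp only [mem_Ioi, ContinuousMap.add_apply, ContinuousMap.one_apply,
        ContinuousMap.smul_apply, smul_eq_mul]
      linarith
    rw [map_add, map_smul, smul_eq_mul, div_mul_cancel₀ _ hpos.ne'] at this
    linarith
  have hcF : c * F 1 ≤ u := by
    by_contra! hlt
    have hF1' : F 1 < 0 := hF1.trans_le hu0
    have := hFU ((u / F 1) • 1) fun y _ => by
      simpa using (lt_div_iff_of_neg hF1').2 hlt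
    rw [map_smul, smul_eq_mul, div_mul_cancel₀ _ hF1'.ne] at this
    exact lt_irrefl _ this
  let L : CompactlySupportedContinuousMap Cantor ℝ →ₗ[ℝ] ℝ :=
    { toFun := fun g => -F g.toContinuousMap
      map_add' := fun f g => by
        rw [← neg_add, ← map_add]
        rfl
      map_smul' := fun a g => by
        rw [RingHom.id_apply, smul_neg, ← map_smul]
        rfl }
  let Λ : CompactlySupportedContinuousMap Cantor ℝ →ₚ[ℝ] ℝ :=
    PositiveLinearMap.mk₀ L fun g hg => neg_nonneg.2 (hneg g.toContinuousMap fun y => hg y)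
  have hreal : ∀ (K : Set Cantor) (g : C(Cantor, ℝ)), IsClopen K → ⇑g = K.indicator 1 →
      (RealRMK.rieszMeasure Λ).real K = -F g := by
    intro K g hK hg
    rw [← integral_indicator_one hK.isOpen.measurableSet, ← hg]
    exact RealRMK.integral_rieszMeasure Λ (CompactlySupportedContinuousMap.continuousMapEquiv g)
  have huniv : (RealRMK.rieszMeasure Λ).real univ = -F 1 :=
    hreal univ 1 isClopen_univ (by simp)
  refine ⟨RealRMK.rieszMeasure Λ, inferInstance, by rw [huniv]; linarith, fun K hK => ?_⟩
  let g : C(Cantor, ℝ) := ⟨K.indicator 1, (hS K hK).continuous_indicator continuous_one⟩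
  rw [huniv, hreal K g (hS K hK) rfl]
  have := hFT g (subset_convexHull ℝ T ⟨K, hK, rfl⟩)
  linarith

theorem exists_disjoint_volume_eq {ι : Type*} (s : Finset ι) {w : ι → ℝ} (hw : ∀ i, 0 ≤ w i) :
    ∃ I : ι → Set ℝ, (∀ i ∈ s, MeasurableSet (I i)) ∧ (∀ i ∈ s, I i ⊆ Ico 0 (∑ i ∈ s, w i)) ∧
      (s : Set ι).PairwiseDisjoint I ∧ ∀ i ∈ s, volume (I i) = ENNReal.ofReal (w i) := by
  classical
  induction s using Finset.induction_on with
  | empty => exact ⟨fun _ => ∅, by simp⟩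
  | insert a s ha ih =>
    obtain ⟨I, hm, hsub, hd, hv⟩ := ih
    have hne : ∀ i ∈ s, i ≠ a := fun i hi h => ha (h ▸ hi)
    have hs : 0 ≤ ∑ i ∈ s, w i := Finset.sum_nonneg fun i _ => hw i
    refine ⟨Function.update I a (Ico (∑ i ∈ s, w i) (w a + ∑ i ∈ s, w i)), ?_, ?_, ?_, ?_⟩
    · refine Finset.forall_mem_insert _ _ _ |>.2 ⟨by simp, fun i hi => ?_⟩
      simpa [hne i hi] using hm i hi
    · rw [Finset.sum_insert ha]
      refine Finset.forall_mem_insert _ _ _ |>.2 ⟨?_, fun i hi => ?_⟩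
      · simpa using Ico_subset_Ico_left hs
      · simpa [hne i hi] using (hsub i hi).trans (Ico_subset_Ico_right (by linarith [hw a]))
    · rw [Finset.coe_insert, pairwiseDisjoint_insert_of_notMem (by simpa using ha)]
      refine ⟨fun i hi j hj hij => ?_, fun i hi => ?_⟩
      · simpa [Function.onFun, hne i hi, hne j hj] using hd hi hj hij
      · simp only [Function.update_self, Function.update_of_ne (hne i hi)]
        exact disjoint_left.2 fun x hx hxi => not_lt_of_ge hx.1 (hsub i hi hxi).2
    · refine Finset.forall_mem_insert _ _ _ |>.2 ⟨by simp, fun i hi => ?_⟩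
      simpa [hne i hi] using hv i hi

namespace Maharam

variable {φ : Set Cantor → ℝ≥0}

theorem exists_control_measure_of_convexHull (hφ : Maharam φ) {ε : ℝ≥0} (hε : 0 < ε)
    (h : ∀ f ∈ convexHull ℝ {f : C(Cantor, ℝ) |
      ∃ K ∈ {K : Set Cantor | IsClopen K ∧ φ K ≤ ε}, ⇑f = K.indicator 1}, ∃ y, f y ≤ 1 - ε) :
    ∃ B : Set Cantor, MeasurableSet B ∧ φ B ≠ 0 ∧ ∃ ν : Measure Cantor, IsFiniteMeasure ν ∧
      ∀ C : Set Cantor, MeasurableSet C → C ⊆ B → (ν C = 0 ↔ φ C = 0) := by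
  have hε' : (0 : ℝ) < ε := hε
  obtain ⟨lam, _, hpos, hle⟩ := exists_measure_real_le_mul
    (S := {K : Set Cantor | IsClopen K ∧ φ K ≤ ε}) (fun K hK => hK.1)
    ⟨isClopen_empty, hφ.map_empty.le.trans zero_le⟩ (by linarith) h
  refine hφ.exists_control_measure lam fun A hA hφA heq => ?_
  set m := lam.real univ with hm
  have hAm : lam.real A = m := congrArg ENNReal.toReal heq
  obtain ⟨K, hK, hlt⟩ := (hφ.add (of_measure lam)).exists_isClopen_symmDiff_lt hA
    (δ := min ε ⟨ε * m, by positivity⟩) (lt_min hε (mul_pos hε' hpos))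
  have hKm := hK.isOpen.measurableSet
  have hAK := hA.symmDiff hKm
  have hφK : φ K ≤ ε := by
    refine (hφ.le_of_subset_union hKm hA hAK fun x hx => ?_).trans ?_
    · simp only [mem_union, mem_symmDiff]
      tauto
    · rw [hφA, zero_add]
      exact le_self_add.trans (hlt.le.trans (min_le_left _ _))
  have hlam : lam.real (symmDiff A K) < ε * m :=
    NNReal.coe_lt_coe.2 (le_add_self.trans_lt (hlt.trans_le (min_le_right _ _)))
  have hA' : lam.real A ≤ lam.real K + lam.real (symmDiff A K) := by
    refine (measureReal_mono fun x hx => ?_).trans (measureReal_union_le _ _)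
    simp only [mem_union, mem_symmDiff]
    tauto
  have := hle K ⟨hK, hφK⟩
  linarith

theorem exists_control_measure_or_prod (hφ : Maharam φ) {ε : ℝ≥0} (hε : 0 < ε) :
    (∃ B : Set Cantor, MeasurableSet B ∧ φ B ≠ 0 ∧ ∃ ν : Measure Cantor, IsFiniteMeasure ν ∧
      ∀ C : Set Cantor, MeasurableSet C → C ⊆ B → (ν C = 0 ↔ φ C = 0)) ∨
    ∃ C : Set (ℝ × Cantor), MeasurableSet C ∧ (∀ x, φ {y | (x, y) ∈ C} ≤ ε) ∧
      ∀ y, volume (Icc (0 : ℝ) 1 \ {x | (x, y) ∈ C}) ≤ ε := by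
  classical
  refine or_iff_not_imp_left.2 fun hB => ?_
  obtain ⟨f, hf, hfy⟩ : ∃ f ∈ convexHull ℝ {f : C(Cantor, ℝ) |
      ∃ K ∈ {K : Set Cantor | IsClopen K ∧ φ K ≤ ε}, ⇑f = K.indicator 1}, ∀ y, 1 - ε < f y := by
    by_contra! h
    exact hB (hφ.exists_control_measure_of_convexHull hε h)
  obtain ⟨ι, _, w, z, hw0, hw1, hz, rfl⟩ := mem_convexHull_iff_exists_fintype.1 hf
  choose K hK hzK using hz
  obtain ⟨I, hIm, hIsub, hId, hIv⟩ := exists_disjoint_volume_eq Finset.univ hw0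
  simp only [Finset.mem_univ, true_imp_iff, hw1] at hIm hIsub hIv
  have hKm : ∀ i, MeasurableSet (K i) := fun i => (hK i).1.isOpen.measurableSet
  have hC : MeasurableSet (⋃ i, I i ×ˢ K i) := .iUnion fun i => (hIm i).prod (hKm i)
  refine ⟨⋃ i, I i ×ˢ K i, hC, fun x => ?_, fun y => ?_⟩
  · have hm : MeasurableSet {y | (x, y) ∈ ⋃ i, I i ×ˢ K i} := measurable_prodMk_left hC
    by_cases hx : ∃ i, x ∈ I i
    · obtain ⟨i, hi⟩ := hx
      refine (hφ.mono hm (hKm i) fun y hy => ?_).trans (hK i).2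
      obtain ⟨j, hj⟩ := mem_iUnion.1 hy
      rcases eq_or_ne i j with rfl | hij
      · exact hj.2
      · exact (disjoint_left.1 (hId (by simp) (by simp) hij) hi hj.1).elim
    · have he : {y | (x, y) ∈ ⋃ i, I i ×ˢ K i} = ∅ := by
        refine eq_empty_of_forall_notMem fun y hy => hx ?_
        obtain ⟨j, hj⟩ := mem_iUnion.1 hy
        exact ⟨j, hj.1⟩
      rw [he, hφ.map_empty]
      exact zero_le
  · set s : Finset ι := {i | y ∈ K i} with hs
    have hVsub : ⋃ i ∈ s, I i ⊆ Icc 0 1 :=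
      iUnion₂_subset fun i _ => (hIsub i).trans Ico_subset_Icc_self
    have hVm : MeasurableSet (⋃ i ∈ s, I i) := s.measurableSet_biUnion fun i _ => hIm i
    have hV : volume (⋃ i ∈ s, I i) = ENNReal.ofReal (∑ i ∈ s, w i) := by
      rw [measure_biUnion_finset (hId.subset (by simp)) fun i _ => hIm i,
        ENNReal.ofReal_sum_of_nonneg fun i _ => hw0 i]
      exact Finset.sum_congr rfl fun i _ => hIv i
    have hsum : 1 - ε < ∑ i ∈ s, w i := by
      refine (hfy y).trans_eq ?_
      simp [hzK, hs, Finset.sum_filter, indicator_apply]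
    have hsub : Icc (0 : ℝ) 1 \ {x | (x, y) ∈ ⋃ i, I i ×ˢ K i} ⊆ Icc 0 1 \ ⋃ i ∈ s, I i := by
      refine sdiff_subset_sdiff_right (iUnion₂_subset fun i hi x hx => ?_)
      exact mem_iUnion.2 ⟨i, hx, by simpa [hs] using hi⟩
    refine (measure_mono hsub).trans ?_
    rw [measure_sdiff hVsub hVm.nullMeasurableSet (measure_ne_top_of_subset hVsub (by simp)), hV,
      Real.volume_Icc, ← ENNReal.ofReal_sub _ (Finset.sum_nonneg fun i _ => hw0 i),
      ← ENNReal.ofReal_coe_nnreal]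
    exact ENNReal.ofReal_le_ofReal (by linarith)

/-- If `φ` has no control measure on a positive set, then `φ` and Lebesgue measure violate the
Fubini property. -/
theorem exists_prod_of_forall_not_control (hφ : Maharam φ)
    (h : ¬ ∃ B : Set Cantor, MeasurableSet B ∧ φ B ≠ 0 ∧ ∃ ν : Measure Cantor, IsFiniteMeasure ν ∧
      ∀ C : Set Cantor, MeasurableSet C → C ⊆ B → (ν C = 0 ↔ φ C = 0)) :
    ∃ C : Set (ℝ × Cantor), MeasurableSet C ∧ C ⊆ (Icc (0:ℝ) 1) ×ˢ univ ∧
      (∀ x ∈ Icc (0:ℝ) 1, φ {y | (x, y) ∈ C} = 0) ∧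
      (∀ y : Cantor, volume (Icc (0:ℝ) 1 \ {x | (x, y) ∈ C}) = 0) := by
  have hpow : ∀ n : ℕ, (0 : ℝ≥0) < (1 / 2) ^ n := fun n => by positivity
  choose D hDm hDφ hDv using
    fun n : ℕ => (hφ.exists_control_measure_or_prod (hpow n)).resolve_left h
  have hE : ∀ m, MeasurableSet (⋂ n ≥ m, D n) :=
    fun m => .iInter fun n => .iInter fun _ => hDm n
  refine ⟨(Icc (0:ℝ) 1) ×ˢ univ ∩ ⋃ m, ⋂ n ≥ m, D n,
    (measurableSet_Icc.prod .univ).inter (.iUnion hE), inter_subset_left, fun x hx => ?_,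
    fun y => ?_⟩
  · have hs : {y | (x, y) ∈ (Icc (0:ℝ) 1) ×ˢ univ ∩ ⋃ m, ⋂ n ≥ m, D n} =
        ⋃ m, {y | (x, y) ∈ ⋂ n ≥ m, D n} := by
      ext y
      simp [hx.1, hx.2]
    have hm : ∀ m, MeasurableSet {y | (x, y) ∈ ⋂ n ≥ m, D n} :=
      fun m => measurable_prodMk_left (hE m)
    rw [hs]
    refine hφ.iUnion_null hm fun m => le_antisymm (ge_of_tendsto
      (tendsto_pow_atTop_nhds_zero_of_lt_one (zero_le (a := (1 / 2 : ℝ≥0))) (by norm_num))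
      ((eventually_ge_atTop m).mono fun n hn => ?_)) zero_le
    refine (hφ.mono (hm m) (measurable_prodMk_left (hDm n)) fun y hy => ?_).trans (hDφ n x)
    exact mem_iInter₂.1 hy n hn
  · have hsum : ∑' n, volume (Icc (0:ℝ) 1 \ {x | (x, y) ∈ D n}) ≠ ⊤ := by
      refine ne_top_of_le_ne_top ?_ (ENNReal.tsum_le_tsum fun n => hDv n y)
      rw [ENNReal.tsum_coe_ne_top_iff_summable]
      exact NNReal.summable_geometric (by norm_num)
    refine measure_mono_null (fun x hx => ?_) (measure_setOfPred_frequently_eq_zero hsum)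
    by_contra hnot
    obtain ⟨m, hm⟩ := eventually_atTop.1 (not_frequently.1 hnot)
    refine hx.2 ⟨⟨hx.1, mem_univ y⟩, mem_iUnion.2 ⟨m, mem_iInter₂.2 fun n hn => ?_⟩⟩
    by_contra hxn
    exact hm n hn ⟨hx.1, hxn⟩

end Maharam

theorem measure_eq_zero_of_prod {lam : Measure Cantor} [IsFiniteMeasure lam] {B : Set Cantor}
    {C : Set (ℝ × Cantor)} (hC : MeasurableSet C)
    (hx : ∀ x ∈ Icc (0:ℝ) 1, lam ({y | (x, y) ∈ C} ∩ B) = 0)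
    (hy : ∀ y, volume (Icc (0:ℝ) 1 \ {x | (x, y) ∈ C}) = 0) : lam B = 0 := by
  have h0 : ((volume.restrict (Icc (0:ℝ) 1)).prod (lam.restrict B)) C = 0 := by
    rw [Measure.measure_prod_null hC]
    filter_upwards [ae_restrict_mem measurableSet_Icc] with x hxI
    rw [Measure.restrict_apply (measurable_prodMk_left hC)]
    exact hx x hxI
  have h1 : ((volume.restrict (Icc (0:ℝ) 1)).prod (lam.restrict B)) Cᶜ = 0 := by
    rw [Measure.prod_apply_symm hC.compl]
    refine (lintegral_congr fun y => ?_).trans lintegral_zero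
    rw [Measure.restrict_apply (measurable_prodMk_right hC.compl), inter_comm]
    exact hy y
  have hu : ((volume.restrict (Icc (0:ℝ) 1)).prod (lam.restrict B)) univ = 0 := by
    rw [← union_compl_self C]
    exact measure_union_null h0 h1
  simpa [← univ_prod_univ, Measure.prod_prod] using hu

/-- Christensen's dichotomy: for a diffuse Maharam submeasure `φ`, exactly one
of the following holds: (1) some `φ`-positive Borel set carries a control
measure for `φ`; (2) there is a Borel set `C ⊆ [0,1] × 2^ℕ` with all vertical
sections `φ`-null and all horizontal sections of full Lebesgue measure. -/
theorem stmt7 (φ : Set Cantor → ℝ≥0) (hφ : Maharam φ) (hd : Diffuse φ) :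
    Xor'
      (∃ B : Set Cantor, MeasurableSet B ∧ φ B ≠ 0 ∧
        ∃ lam : MeasureTheory.Measure Cantor, MeasureTheory.IsFiniteMeasure lam ∧
          ∀ C : Set Cantor, MeasurableSet C → C ⊆ B → (lam C = 0 ↔ φ C = 0))
      (∃ C : Set (ℝ × Cantor), MeasurableSet C ∧ C ⊆ (Icc (0:ℝ) 1) ×ˢ univ ∧
        (∀ x ∈ Icc (0:ℝ) 1, φ {y | (x, y) ∈ C} = 0) ∧
        (∀ y : Cantor, MeasureTheory.volume (Icc (0:ℝ) 1 \ {x | (x, y) ∈ C}) = 0)) := by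
  refine (xor_iff_or_and_not_and _ _).2 ?_
  refine ⟨or_iff_not_imp_left.2 hφ.exists_prod_of_forall_not_control, ?_⟩
  rintro ⟨⟨B, hB, hφB, lam, _, hlam⟩, C, hC, -, hx, hy⟩
  refine hφB ((hlam B hB subset_rfl).1 (measure_eq_zero_of_prod hC (fun x hxI => ?_) hy))
  have hCx : MeasurableSet {y | (x, y) ∈ C} := measurable_prodMk_left hC
  exact (hlam _ (hCx.inter hB) inter_subset_right).2 (le_antisymm
    ((hφ.mono (hCx.inter hB) hCx inter_subset_left).trans (hx x hxI).le) zero_le)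
end

section
/- Let ψ be a normalized pathological submeasure on the Borel subsets of Cantor space 2^ℕ. Then for every natural number n there are pairwise disjoint Borel sets A_0, …, A_{n-1} with ψ(A_i) ≥ 1/3 for each i < n. -/
open Set Filter NNReal

theorem pow_succ_div_factorial_mul_le (r : ℕ) :
    (r : ℝ) ^ (r + 1) / (r + 1).factorial * ((r : ℝ) ^ (r + 1) / r.factorial) ≤ 18 ^ r := by
  have he : Real.exp r ≤ 3 ^ r := by
    rw [← Real.exp_one_pow]
    exact pow_le_pow_left₀ (Real.exp_pos 1).le Real.exp_one_lt_three.le r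
  have h1 : (r : ℝ) ^ r / r.factorial ≤ 3 ^ r :=
    (Real.pow_div_factorial_le_exp _ (Nat.cast_nonneg r) r).trans he
  have h2 : (r : ℝ) ^ (r + 1) / (r + 1).factorial ≤ 3 ^ r :=
    (Real.pow_div_factorial_le_exp _ (Nat.cast_nonneg r) (r + 1)).trans he
  have h3 : (r : ℝ) ≤ 2 ^ r := by exact_mod_cast (Nat.lt_two_pow_self (n := r)).le
  calc (r : ℝ) ^ (r + 1) / (r + 1).factorial * ((r : ℝ) ^ (r + 1) / r.factorial)
      = (r : ℝ) ^ (r + 1) / (r + 1).factorial * (r * ((r : ℝ) ^ r / r.factorial)) := by ring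
    _ ≤ 3 ^ r * (2 ^ r * 3 ^ r) := by gcongr
    _ = 18 ^ r := by rw [← mul_pow, ← mul_pow]; norm_num

/-- An upper bound for the number of edge-coloured graphs in which `r + 1` edges, with colours in a
fixed set of size `k`, span at most `r` vertices. -/
theorem config_count_le {n m k l : ℕ} (hn : 0 < n) (hm : 0 < m) (hl : 0 < l)
    (h : 36 * n * k ≤ m) (r : ℕ) :
    ((l.choose r * (n * l).choose (r + 1) *
      ((r * (r * k)) ^ (r + 1) * (l * (l * m)) ^ (n * l - (r + 1))) : ℕ) : ℝ) ≤
      (l * (l * m) : ℝ) ^ (n * l) / l * (1 / 2) ^ (r + 1) := by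
  rcases lt_or_ge (n * l) (r + 1) with hr | hr
  · rw [Nat.choose_eq_zero_of_lt hr]
    simp only [mul_zero, zero_mul, Nat.cast_zero]
    positivity
  have hl' : (0 : ℝ) < l := by exact_mod_cast hl
  have hm' : (0 : ℝ) < m := by exact_mod_cast hm
  have hn' : (0 : ℝ) < n := by exact_mod_cast hn
  have h' : (n : ℝ) * k / m ≤ 1 / 36 := by
    rw [div_le_div_iff₀ hm' (by norm_num)]
    have : ((36 * n * k : ℕ) : ℝ) ≤ m := by exact_mod_cast h
    push_cast at this
    linarith
  have c1 : (l.choose r : ℝ) ≤ (l : ℝ) ^ r / r.factorial := Nat.choose_le_pow_div r l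
  have c2 : ((n * l).choose (r + 1) : ℝ) ≤ (n * l : ℝ) ^ (r + 1) / (r + 1).factorial := by
    exact_mod_cast Nat.choose_le_pow_div (α := ℝ) (r + 1) (n * l)
  have hq : (l * (l * m) : ℝ) ^ (n * l) =
      (l * (l * m) : ℝ) ^ (n * l - (r + 1)) * (l * (l * m) : ℝ) ^ (r + 1) := by
    rw [← pow_add, Nat.sub_add_cancel hr]
  push_cast
  calc (l.choose r : ℝ) * ((n * l).choose (r + 1)) *
        ((r * (r * k)) ^ (r + 1) * (l * (l * m)) ^ (n * l - (r + 1)))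
      ≤ ((l : ℝ) ^ r / r.factorial) * ((n * l : ℝ) ^ (r + 1) / (r + 1).factorial) *
        ((r * (r * k)) ^ (r + 1) * (l * (l * m)) ^ (n * l - (r + 1))) := by gcongr
    _ = (l * (l * m) : ℝ) ^ (n * l) / l * ((n * k / m) ^ (r + 1) *
        ((r : ℝ) ^ (r + 1) / (r + 1).factorial * ((r : ℝ) ^ (r + 1) / r.factorial))) := by
      rw [hq, div_pow]
      field_simp
      ring
    _ ≤ (l * (l * m) : ℝ) ^ (n * l) / l * ((1 / 36) ^ (r + 1) * 18 ^ r) := by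
      gcongr
      exact pow_succ_div_factorial_mul_le r
    _ ≤ (l * (l * m) : ℝ) ^ (n * l) / l * (1 / 2) ^ (r + 1) := by
      gcongr
      calc (1 / 36 : ℝ) ^ (r + 1) * 18 ^ r ≤ (1 / 36 : ℝ) ^ (r + 1) * 18 ^ (r + 1) := by
            gcongr <;> norm_num
        _ = (1 / 2) ^ (r + 1) := by rw [← mul_pow]; norm_num

open Finset in
/-- There is a graph on `l` vertices with `n * l` edges coloured by `m` colours, such that any set of
edges using at most `k` colours spans at least as many vertices as it has edges. -/
theorem exists_edge_coloured_graph {n m k : ℕ} (hn : 0 < n) (hm : 0 < m) (h : 36 * n * k ≤ m) :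
    ∃ l : ℕ, 0 < l ∧ ∃ e : Fin (n * l) → Fin l × Fin l × Fin m,
      ∀ T : Finset (Fin m), #T ≤ k → ∀ S : Finset (Fin (n * l)), (∀ a ∈ S, (e a).2.2 ∈ T) →
        #S ≤ #(S.biUnion fun a => {(e a).1, (e a).2.1}) := by
  obtain ⟨l, hl⟩ : ∃ l, l = 2 ^ m := ⟨_, rfl⟩
  have hl0 : 0 < l := hl ▸ by positivity
  refine ⟨l, hl0, ?_⟩
  by_contra! hbad
  let P (S : Finset (Fin (n * l))) (J : Finset (Fin l)) (T : Finset (Fin m)) :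
      Finset (Fin (n * l) → Fin l × Fin l × Fin m) :=
    Fintype.piFinset fun a => if a ∈ S then J ×ˢ J ×ˢ T else univ
  have hP : ∀ r, ∀ S ∈ powersetCard (r + 1) (univ : Finset (Fin (n * l))),
      ∀ J ∈ powersetCard r (univ : Finset (Fin l)), ∀ T : Finset (Fin m), #T ≤ k →
      #(P S J T) ≤ (r * (r * k)) ^ (r + 1) * (l * (l * m)) ^ (n * l - (r + 1)) := by
    intro r S hS J hJ T hT
    rw [mem_powersetCard] at hS hJ
    have hc : #(univ \ S) = n * l - (r + 1) := by
      rw [card_sdiff_of_subset (subset_univ _), hS.2]; simp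
    simp only [P, Fintype.card_piFinset]
    rw [← prod_sdiff (subset_univ S), mul_comm]
    refine Nat.mul_le_mul ?_ ?_
    · rw [← hS.2]
      refine prod_le_pow_card _ _ _ fun a ha => ?_
      rw [if_pos ha, card_product, card_product, hJ.2]
      gcongr
    · rw [← hc]
      refine prod_le_pow_card _ _ _ fun a ha => ?_
      rw [if_neg (mem_sdiff.1 ha).2]
      simp
  have hcover : (univ : Finset (Fin (n * l) → Fin l × Fin l × Fin m)) ⊆
      (univ.filter fun T : Finset (Fin m) => #T ≤ k).biUnion fun T =>
        (range (l + 1)).biUnion fun r =>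
          (powersetCard r (univ : Finset (Fin l))).biUnion fun J =>
            (powersetCard (r + 1) (univ : Finset (Fin (n * l)))).biUnion fun S => P S J T := by
    intro e _
    obtain ⟨T, hT, S, hST, hS⟩ := hbad e
    set J := S.biUnion fun a => ({(e a).1, (e a).2.1} : Finset (Fin l)) with hJ
    obtain ⟨S', hS'S, hS'⟩ := exists_subset_card_eq (Nat.succ_le_of_lt hS)
    simp only [Finset.mem_biUnion, Finset.mem_filter, Finset.mem_univ, true_and, Finset.mem_range,
      mem_powersetCard, Finset.subset_univ]
    refine ⟨T, hT, #J, Nat.lt_succ_of_le (by simpa using card_le_univ J), J, rfl, S', hS', ?_⟩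
    simp only [P, Fintype.mem_piFinset]
    intro a
    split_ifs with ha
    · simp only [Finset.mem_product, hJ, Finset.mem_biUnion]
      exact ⟨⟨a, hS'S ha, by simp⟩, ⟨a, hS'S ha, by simp⟩, hST a (hS'S ha)⟩
    · exact Finset.mem_univ _
  have hcard : (l * (l * m)) ^ (n * l) ≤
      ∑ T ∈ univ.filter (fun T : Finset (Fin m) => #T ≤ k), ∑ r ∈ range (l + 1),
        l.choose r * (n * l).choose (r + 1) *
          ((r * (r * k)) ^ (r + 1) * (l * (l * m)) ^ (n * l - (r + 1))) := by
    have := Finset.card_le_card hcover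
    rw [Finset.card_univ] at this
    simp only [Fintype.card_fun, Fintype.card_prod, Fintype.card_fin] at this
    refine this.trans (card_biUnion_le.trans (sum_le_sum fun T hT => ?_))
    refine card_biUnion_le.trans (sum_le_sum fun r _ => ?_)
    rw [mul_assoc]
    calc _ ≤ #(powersetCard r (univ : Finset (Fin l))) * _ :=
          card_biUnion_le_card_mul _ _ _ fun J hJ =>
            card_biUnion_le_card_mul _ _ _ fun S hS => hP r S hS J hJ T (mem_filter.1 hT).2
      _ = _ := by simp [card_powersetCard]
  have hq : (0 : ℝ) < (l * (l * m) : ℝ) ^ (n * l) := by positivity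
  have hgeom : ∑ r ∈ range (l + 1), (1 / 2 : ℝ) ^ (r + 1) < 1 := by
    have : ∀ N : ℕ, ∑ r ∈ range N, (1 / 2 : ℝ) ^ (r + 1) = 1 - (1 / 2) ^ N := by
      intro N
      induction N with
      | zero => simp
      | succ N ih => rw [sum_range_succ, ih]; ring
    rw [this]
    have : (0 : ℝ) < (1 / 2) ^ (l + 1) := by positivity
    linarith
  have hfilter : (#(univ.filter fun T : Finset (Fin m) => #T ≤ k) : ℝ) ≤ l := by
    have := card_filter_le (univ : Finset (Finset (Fin m))) (fun T => #T ≤ k)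
    rw [card_univ, Fintype.card_finset, Fintype.card_fin, ← hl] at this
    exact_mod_cast this
  have : (l * (l * m) : ℝ) ^ (n * l) < (l * (l * m) : ℝ) ^ (n * l) := calc
    (l * (l * m) : ℝ) ^ (n * l) ≤ ∑ T ∈ univ.filter (fun T : Finset (Fin m) => #T ≤ k),
        ∑ r ∈ range (l + 1), (l * (l * m) : ℝ) ^ (n * l) / l * (1 / 2) ^ (r + 1) := by
      have := (Nat.cast_le (α := ℝ)).2 hcard
      push_cast at this
      refine this.trans ?_
      refine sum_le_sum fun T _ => sum_le_sum fun r _ => ?_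
      have := config_count_le hn hm hl0 h r
      push_cast at this
      exact this
    _ = #(univ.filter fun T : Finset (Fin m) => #T ≤ k) *
        ((l * (l * m) : ℝ) ^ (n * l) / l * ∑ r ∈ range (l + 1), (1 / 2 : ℝ) ^ (r + 1)) := by
      rw [sum_const, nsmul_eq_mul, ← mul_sum]
    _ ≤ l * ((l * (l * m) : ℝ) ^ (n * l) / l * ∑ r ∈ range (l + 1), (1 / 2 : ℝ) ^ (r + 1)) := by
      gcongr
    _ = (l * (l * m) : ℝ) ^ (n * l) * ∑ r ∈ range (l + 1), (1 / 2 : ℝ) ^ (r + 1) := by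
      field_simp
    _ < (l * (l * m) : ℝ) ^ (n * l) * 1 := by gcongr
    _ = _ := mul_one _
  exact lt_irrefl _ this

/-- Endpoints can be chosen injectively along the edges whose colour lies in a small set. -/
theorem exists_edge_orientation {n m k : ℕ} (hn : 0 < n) (hm : 0 < m) (h : 36 * n * k ≤ m) :
    ∃ l : ℕ, 0 < l ∧ ∃ (u v : Fin (n * l) → Fin l) (c : Fin (n * l) → Fin m)
      (f : Finset (Fin m) → Fin (n * l) → Fin l), ∀ T : Finset (Fin m), T.card ≤ k →
        InjOn (f T) {a | c a ∈ T} ∧ ∀ a, c a ∈ T → f T a = u a ∨ f T a = v a := by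
  obtain ⟨l, hl, e, he⟩ := exists_edge_coloured_graph hn hm h
  have key : ∀ T : Finset (Fin m), ∃ g : Fin (n * l) → Fin l, T.card ≤ k →
      InjOn g {a | (e a).2.2 ∈ T} ∧ ∀ a, (e a).2.2 ∈ T → g a = (e a).1 ∨ g a = (e a).2.1 := by
    intro T
    by_cases hT : T.card ≤ k
    swap
    · exact ⟨fun _ => ⟨0, hl⟩, fun h => absurd h hT⟩
    obtain ⟨g, hg, hg'⟩ := (Finset.all_card_le_biUnion_card_iff_exists_injective
      (fun a : {a // (e a).2.2 ∈ T} => ({(e a).1, (e a).2.1} : Finset (Fin l)))).1 fun S => by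
        have := he T hT (S.map (Function.Embedding.subtype _)) (by simp +contextual)
        rwa [Finset.card_map, Finset.map_eq_image, Finset.image_biUnion] at this
    refine ⟨fun a => if ha : (e a).2.2 ∈ T then g ⟨a, ha⟩ else ⟨0, hl⟩, fun _ => ⟨?_, ?_⟩⟩
    · intro a ha b hb hab
      simp only [mem_ofPred_eq] at ha hb
      simp only [ha, hb, dif_pos] at hab
      exact congrArg Subtype.val (hg hab)
    · intro a ha
      simpa only [ha, dif_pos, Finset.mem_insert, Finset.mem_singleton] using hg' ⟨a, ha⟩
  choose f hf using key
  exact ⟨l, hl, fun a => (e a).1, fun a => (e a).2.1, fun a => (e a).2.2, f, hf⟩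

/-- If `B` is a family of `m` sets such that every point lies in few of them, then many of its
members (with repetition) split into two pieces so that the pieces with a common index are
disjoint; some index then carries `n` large pieces. -/
theorem exists_disjoint_of_small_multiplicity {X : Type*} [MeasurableSpace X] {ψ : Set X → ℝ≥0}
    (hsub : ∀ A B : Set X, MeasurableSet A → MeasurableSet B → ψ (A ∪ B) ≤ ψ A + ψ B)
    (hmono : ∀ A B : Set X, MeasurableSet A → MeasurableSet B → A ⊆ B → ψ A ≤ ψ B)
    {n m k : ℕ} (hn : 0 < n) (hm : 0 < m) (h : 36 * n * k ≤ m) {r : ℝ≥0}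
    (B : Fin m → Set X) (hB : ∀ i, MeasurableSet (B i)) (hBψ : ∀ i, r + r ≤ ψ (B i))
    (hBk : ∀ x, {i | x ∈ B i}.ncard ≤ k) :
    ∃ A : Fin n → Set X, (∀ i, MeasurableSet (A i)) ∧
      (Pairwise fun i j => Disjoint (A i) (A j)) ∧ ∀ i, r ≤ ψ (A i) := by
  classical
  obtain ⟨l, hl, u, v, c, f, hf⟩ := exists_edge_orientation hn hm h
  let E (x : X) : Finset (Fin m) := Finset.univ.filter fun i => x ∈ B i
  have hE : ∀ x, (E x).card ≤ k := fun x => by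
    rw [← Set.ncard_coe_finset]
    simpa [E] using hBk x
  have hEmem : ∀ x i, i ∈ E x ↔ x ∈ B i := fun x i => by simp [E]
  let C (a : Fin (n * l)) (j : Fin l) : Set X := {x | x ∈ B (c a) ∧ f (E x) a = j}
  have hEmeas : ∀ p : Finset (Fin m) → Prop, MeasurableSet {x | p (E x)} := by
    intro p
    have : {x | p (E x)} = ⋃ T : {T // p T}, ⋂ i, {x | x ∈ B i ↔ i ∈ T.1} := by
      ext x
      simp only [mem_ofPred_eq, mem_iUnion, mem_iInter, Subtype.exists, exists_prop]
      constructor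
      · exact fun hx => ⟨E x, hx, fun i => (hEmem x i).symm⟩
      · rintro ⟨T, hT, hx⟩
        have : E x = T := by ext i; rw [hEmem, hx]
        rwa [this]
    rw [this]
    refine MeasurableSet.iUnion fun T => MeasurableSet.iInter fun i => ?_
    by_cases hi : i ∈ T.1
    · simpa [hi] using hB i
    · simp only [hi, iff_false]
      exact (hB i).compl
  have hC : ∀ a j, MeasurableSet (C a j) := fun a j =>
    (hB (c a)).inter (hEmeas fun T => f T a = j)
  have hw : ∀ a, ∃ j, r ≤ ψ (C a j) := by
    intro a
    by_contra! hlt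
    have hle : ψ (B (c a)) ≤ ψ (C a (u a)) + ψ (C a (v a)) := by
      refine (hmono _ _ (hB _) ((hC a (u a)).union (hC a (v a))) fun x hx => ?_).trans
        (hsub _ _ (hC a (u a)) (hC a (v a)))
      rcases (hf (E x) (hE x)).2 a ((hEmem x _).2 hx) with h | h
      · exact Or.inl ⟨hx, h⟩
      · exact Or.inr ⟨hx, h⟩
    exact absurd ((hBψ (c a)).trans hle) (not_le.2 (add_lt_add (hlt _) (hlt _)))
  choose w hw using hw
  have : Nonempty (Fin l) := ⟨⟨0, hl⟩⟩
  obtain ⟨j, hj⟩ := Fintype.exists_le_card_fiber_of_mul_le_card w (n := n)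
    (by simp [mul_comm])
  obtain ⟨S, hS, hSn⟩ := Finset.exists_subset_card_eq hj
  have hSj : ∀ i, w (S.orderEmbOfFin hSn i) = j := fun i => by
    simpa using hS (S.orderEmbOfFin_mem hSn i)
  refine ⟨fun i => C (S.orderEmbOfFin hSn i) j, fun i => hC _ _, fun i i' hii' => ?_, fun i => ?_⟩
  · refine Set.disjoint_left.2 ?_
    rintro x ⟨hx, hxj⟩ ⟨hx', hxj'⟩
    exact hii' ((S.orderEmbOfFin hSn).injective ((hf (E x) (hE x)).1 ((hEmem x _).2 hx)
      ((hEmem x _).2 hx') (hxj.trans hxj'.symm)))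
  · have := hw (S.orderEmbOfFin hSn i)
    rwa [hSj] at this

open scoped BoundedContinuousFunction in
/-- By a separation argument, if every finite list of members of `𝒮` leaves some point uncovered by a
proportion more than `δ` of the list, then a probability charge has mass at least `δ` on the
complement of each member of `𝒮`. -/
theorem exists_finitely_additive {X : Type} [Nonempty X] (𝒮 : Set (Set X)) {δ : ℝ}
    (hδ0 : 0 ≤ δ) (hδ1 : δ ≤ 1)
    (h𝒮 : ∀ (ι : Type) [Fintype ι] [Nonempty ι] (A : ι → Set X), (∀ i, A i ∈ 𝒮) →
      ∃ x, δ * Fintype.card ι < {i | x ∉ A i}.ncard) :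
    ∃ μ : Set X → ℝ, (∀ A, 0 ≤ μ A) ∧ μ univ = 1 ∧
      (∀ A B, Disjoint A B → μ (A ∪ B) = μ A + μ B) ∧ ∀ A ∈ 𝒮, δ ≤ μ Aᶜ := by
  classical
  let _ : TopologicalSpace X := ⊥
  have : DiscreteTopology X := ⟨rfl⟩
  let I (A : Set X) : X →ᵇ ℝ := BoundedContinuousFunction.ofNormedAddCommGroupDiscrete
    (A.indicator 1) 1 fun x => by by_cases hx : x ∈ A <;> simp [hx]
  have hI : ∀ A x, I A x = A.indicator 1 x := fun A x => rfl
  let G (A : Set X) : X →ᵇ ℝ := I Aᶜ - δ • I univ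
  have hG : ∀ A x, G A x = (Aᶜ).indicator 1 x - δ := fun A x => by simp [G, hI]
  let K : PointedCone ℝ (X →ᵇ ℝ) :=
    { carrier := {f | ∃ g ∈ Submodule.span ℝ≥0 (G '' 𝒮), ∀ x, g x ≤ f x}
      add_mem' := by
        rintro f f' ⟨g, hg, hgf⟩ ⟨g', hg', hgf'⟩
        exact ⟨g + g', Submodule.add_mem _ hg hg', fun x => add_le_add (hgf x) (hgf' x)⟩
      zero_mem' := ⟨0, Submodule.zero_mem _, fun x => le_rfl⟩
      smul_mem' := by
        rintro c f ⟨g, hg, hgf⟩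
        refine ⟨(c : ℝ≥0) • g, Submodule.smul_mem _ _ hg, fun x => ?_⟩
        exact mul_le_mul_of_nonneg_left (hgf x) c.2 }
  have hneg : ∀ t : ℝ, t • I univ ∈ K → 0 ≤ t := by
    rintro t ⟨g, hg, hgt⟩
    by_contra! ht
    obtain ⟨a, ha⟩ := (Finsupp.mem_span_image_iff_linearCombination ℝ≥0).1 hg
    obtain ⟨ha𝒮, rfl⟩ := ha
    rw [Finsupp.mem_supported] at ha𝒮
    obtain ⟨M, hM⟩ := exists_nat_gt ((a.support.card : ℝ) / -t)
    rw [div_lt_iff₀ (neg_pos.2 ht)] at hM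
    let ι := Σ A : a.support, Fin ⌊M * a A⌋₊
    have hsum : ∀ x, ∑ i : ι, G i.1 x < 0 := by
      intro x
      have h1 : ∑ i : ι, G i.1 x = ∑ A ∈ a.support, (⌊M * a A⌋₊ : ℝ) * G A x := by
        rw [Fintype.sum_sigma, ← Finset.sum_coe_sort a.support]
        simp
      have h2 : ∑ A ∈ a.support, (a A : ℝ) * G A x ≤ t := by
        have := hgt x
        rw [Finsupp.linearCombination_apply, Finsupp.sum] at this
        simpa [hI, NNReal.smul_def] using this
      have h3 : ∑ A ∈ a.support, (⌊M * a A⌋₊ : ℝ) * G A x ≤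
          ∑ A ∈ a.support, (M * (a A * G A x) + 1) := by
        refine Finset.sum_le_sum fun A _ => ?_
        have e1 : (⌊M * a A⌋₊ : ℝ) ≤ M * a A := by
          exact_mod_cast Nat.floor_le (zero_le (a := M * a A))
        have e2 : (M * a A : ℝ) < ⌊M * a A⌋₊ + 1 := by
          exact_mod_cast Nat.lt_floor_add_one (M * a A)
        have e3 : -1 ≤ G A x ∧ G A x ≤ 1 := by
          rw [hG]
          by_cases hx : x ∈ Aᶜ <;> simp only [hx, indicator_of_mem, indicator_of_notMem,
            not_false_eq_true, Pi.one_apply] <;> constructor <;> linarith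
        nlinarith
      rw [Finset.sum_add_distrib, ← Finset.mul_sum] at h3
      simp only [Finset.sum_const, nsmul_eq_mul, mul_one] at h3
      rw [h1]
      have h4 := mul_le_mul_of_nonneg_left h2 (Nat.cast_nonneg (α := ℝ) M)
      linarith
    have : Nonempty ι := by
      by_contra hι
      rw [not_nonempty_iff] at hι
      simpa using hsum (Classical.arbitrary X)
    obtain ⟨x, hx⟩ := h𝒮 ι (fun i => i.1) fun i => ha𝒮 i.1.2
    have := hsum x
    simp only [hG, Finset.sum_sub_distrib, Finset.sum_const, nsmul_eq_mul, Finset.card_univ] at this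
    have h5 : ∑ i : ι, ((i.1 : Set X)ᶜ).indicator (1 : X → ℝ) x =
        {i : ι | x ∉ (i.1 : Set X)}.ncard := by
      simp [indicator_apply, Set.ncard_eq_toFinset_card', Finset.sum_ite]
    rw [h5] at this
    linarith
  have hne : I univ ≠ 0 := fun h0 => by
    simpa [hI] using DFunLike.congr_fun h0 (Classical.arbitrary X)
  obtain ⟨g, hg, hgK⟩ := riesz_extension K (LinearPMap.mkSpanSingleton (I univ) (1 : ℝ) hne)
    (by
      rintro ⟨y, hy⟩ hyK
      obtain ⟨t, rfl⟩ := Submodule.mem_span_singleton.1 hy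
      have := hneg t hyK
      rw [LinearPMap.mkSpanSingleton'_apply]
      simpa using this)
    (fun f => by
      refine ⟨⟨‖f‖ • I univ, Submodule.mem_span_singleton.2 ⟨_, rfl⟩⟩, 0,
        Submodule.zero_mem _, fun x => ?_⟩
      have := (abs_le.1 (f.norm_coe_le_norm x)).1
      simp [hI]
      linarith)
  have hg1 : g (I univ) = 1 := by
    have := hg ⟨(1 : ℝ) • I univ, Submodule.mem_span_singleton.2 ⟨_, rfl⟩⟩
    simpa only [one_smul, map_one] using
      this.trans (LinearPMap.mkSpanSingleton'_apply (σ := RingHom.id ℝ) _ _ _ (1 : ℝ) _)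
  refine ⟨fun A => g (I A), fun A => ?_, hg1, fun A B hAB => ?_, fun A hA => ?_⟩
  · exact hgK _ ⟨0, Submodule.zero_mem _, fun x => indicator_nonneg (fun _ _ => zero_le_one) x⟩
  · change g (I (A ∪ B)) = g (I A) + g (I B)
    rw [← map_add]
    refine congrArg g (BoundedContinuousFunction.ext fun x => ?_)
    simp [hI, indicator_union_of_disjoint hAB]
  · have := hgK (G A) ⟨G A, Submodule.subset_span ⟨A, hA, rfl⟩, fun x => le_rfl⟩
    rw [map_sub, map_smul, hg1] at this
    simpa using this

/-- A probability charge giving mass at least `δ` to the complement of each set of small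
submeasure yields a nonzero additive minorant: restrict it to the complements of sets which
nearly maximize `μ A - 4 * ψ A`, and pass to a limit. -/
theorem exists_finAdd_le_of_compl_mass {ψ : Set Cantor → ℝ≥0} (hψ : Submeasure ψ)
    {μ : Set Cantor → ℝ} (hμ0 : ∀ A, 0 ≤ μ A) (hμ1 : μ univ = 1)
    (hμ : ∀ A B, Disjoint A B → μ (A ∪ B) = μ A + μ B) {δ : ℝ} (hδ : 0 < δ)
    (hμψ : ∀ A, MeasurableSet A → ψ A ≤ 1 / 3 → δ ≤ μ Aᶜ) :
    ∃ ν : Set Cantor → ℝ≥0, FinAdd ν ∧ (∀ A, MeasurableSet A → ν A ≤ ψ A) ∧ ν univ ≠ 0 := by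
  have hμempty : μ ∅ = 0 := by simpa using hμ ∅ ∅ (disjoint_bot_left)
  have hμle : ∀ A, μ A ≤ 1 := fun A => by
    have := hμ A Aᶜ disjoint_compl_right
    rw [union_compl_self, hμ1] at this
    linarith [hμ0 Aᶜ]
  let V : Set ℝ := (fun A => μ A - 4 * ψ A) '' {A | MeasurableSet A}
  have hVbdd : BddAbove V := ⟨1, by
    rintro _ ⟨A, -, rfl⟩
    have : (0 : ℝ) ≤ ψ A := (ψ A).2
    have := hμle A
    dsimp only
    linarith⟩
  have hV0 : (0 : ℝ) ∈ V := ⟨∅, by simp, by simp [hμempty, hψ.1]⟩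
  have hstep : ∀ j : ℕ, ∃ A, MeasurableSet A ∧ sSup V - 1 / ((j : ℝ) + 3) < μ A - 4 * ψ A := by
    intro j
    obtain ⟨_, ⟨A, hA, rfl⟩, hlt⟩ := exists_lt_of_lt_csSup ⟨0, hV0⟩
      (sub_lt_self (sSup V) (by positivity : 0 < 1 / ((j : ℝ) + 3)))
    exact ⟨A, hA, hlt⟩
  choose A hA hAV using hstep
  have hAδ : ∀ j, δ ≤ μ (A j)ᶜ := by
    intro j
    refine hμψ _ (hA j) ?_
    have h1 : 1 / ((j : ℝ) + 3) ≤ 1 / 3 := by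
      gcongr
      linarith [Nat.cast_nonneg (α := ℝ) j]
    have h2 := le_csSup hVbdd hV0
    have h3 := hAV j
    have h4 := hμle (A j)
    have : (ψ (A j) : ℝ) ≤ 1 / 3 := by linarith
    exact_mod_cast this
  have hAψ : ∀ j C, MeasurableSet C → μ (C \ A j) ≤ 4 * ψ C + 1 / ((j : ℝ) + 3) := by
    intro j C hC
    have h1 : μ (A j ∪ C) = μ (A j) + μ (C \ A j) := by
      rw [← union_sdiff_self, hμ _ _ disjoint_sdiff_right]
    have h2 : μ (A j ∪ C) - 4 * ψ (A j ∪ C) ≤ sSup V :=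
      le_csSup hVbdd ⟨_, (hA j).union hC, rfl⟩
    have h3 : (ψ (A j ∪ C) : ℝ) ≤ ψ (A j) + ψ C := by exact_mod_cast hψ.2.2 _ _ (hA j) hC
    have h4 := hAV j
    linarith
  let U : Ultrafilter ℕ := hyperfilter ℕ
  have hU : (U : Filter ℕ) ≤ atTop := Nat.hyperfilter_le_atTop
  have hlim : ∀ C, ∃ x, Tendsto (fun j => μ (C \ A j)) U (nhds x) := by
    intro C
    obtain ⟨x, -, hx⟩ := (isCompact_Icc (a := (0 : ℝ)) (b := 1)).ultrafilter_le_nhds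
      (U.map fun j => μ (C \ A j)) (by
        rw [le_principal_iff]
        exact Filter.mem_map.2 (univ_mem' fun j => ⟨hμ0 _, hμle _⟩))
    exact ⟨x, hx⟩
  choose ν hν using hlim
  have hν0 : ∀ C, 0 ≤ ν C := fun C => ge_of_tendsto' (hν C) fun j => hμ0 _
  refine ⟨fun C => Real.toNNReal (ν C / 4), ⟨?_, fun B C hB hC hBC => ?_⟩, fun C hC => ?_, ?_⟩
  · have : ν ∅ = 0 := tendsto_nhds_unique (hν ∅) (by simp [hμempty])
    simp [this]
  · have : ν (B ∪ C) = ν B + ν C := by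
      refine tendsto_nhds_unique (hν _) (((hν B).add (hν C)).congr fun j => ?_)
      rw [union_sdiff_distrib, hμ _ _ (hBC.mono sdiff_subset sdiff_subset)]
    dsimp only
    rw [this, add_div, Real.toNNReal_add] <;> linarith [hν0 B, hν0 C]
  · have hz : Tendsto (fun j : ℕ => 4 * (ψ C : ℝ) + 1 / ((j : ℝ) + 3)) atTop
        (nhds (4 * ψ C + 0)) := by
      refine tendsto_const_nhds.add ?_
      simp only [one_div]
      exact (tendsto_atTop_add_const_right _ (3 : ℝ) tendsto_natCast_atTop_atTop).inv_tendsto_atTop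
    have := le_of_tendsto_of_tendsto' (hν C) (hz.mono_left hU) fun j => hAψ j C hC
    exact Real.toNNReal_le_iff_le_coe.2 (by linarith)
  · have : δ ≤ ν univ := ge_of_tendsto' (hν univ) fun j => by
      rw [← compl_eq_univ_sdiff]
      exact hAδ j
    exact (Real.toNNReal_pos.2 (by linarith)).ne'

/-- Kalton–Roberts / Louveau: if `ψ` is a normalized pathological submeasure,
then for every `n` there are `n` pairwise disjoint Borel sets of `ψ`-submeasure
at least `1/3`. -/
theorem stmt9 (ψ : Set Cantor → ℝ≥0) (hψ : Submeasure ψ) (hnorm : ψ univ = 1)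
    (hpath : ∀ ν : Set Cantor → ℝ≥0, FinAdd ν →
      (∀ A : Set Cantor, MeasurableSet A → ν A ≤ ψ A) →
      ∀ A : Set Cantor, MeasurableSet A → ν A = 0)
    (n : ℕ) :
    ∃ A : Fin n → Set Cantor, (∀ i, MeasurableSet (A i)) ∧
      (Pairwise fun i j => Disjoint (A i) (A j)) ∧
      ∀ i, (1/3 : ℝ≥0) ≤ ψ (A i) := by
  rcases Nat.eq_zero_or_pos n with rfl | hn
  · exact ⟨fun _ => ∅, fun i => i.elim0, fun i => i.elim0, fun i => i.elim0⟩
  have hn' : (1 : ℝ) ≤ n := by exact_mod_cast hn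
  by_cases h : ∀ (ι : Type) [Fintype ι] [Nonempty ι] (A : ι → Set Cantor),
      (∀ i, A i ∈ {A | MeasurableSet A ∧ ψ A ≤ 1 / 3}) →
      ∃ x, (1 / (36 * n) : ℝ) * Fintype.card ι < {i | x ∉ A i}.ncard
  · obtain ⟨μ, hμ0, hμ1, hμ, hμψ⟩ := exists_finitely_additive _ (by positivity)
      (by rw [div_le_one (by positivity)]; linarith) h
    obtain ⟨ν, hν, hνψ, hν0⟩ := exists_finAdd_le_of_compl_mass hψ hμ0 hμ1 hμ
      (by positivity : (0 : ℝ) < 1 / (36 * n)) fun A hA hAψ => hμψ A ⟨hA, hAψ⟩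
    exact absurd (hpath ν hν hνψ univ MeasurableSet.univ) hν0
  · push Not at h
    obtain ⟨ι, _, _, A, hA, hx⟩ := h
    let e := (Fintype.equivFin ι).symm
    refine exists_disjoint_of_small_multiplicity hψ.2.2 hψ.2.1 hn (Fintype.card_pos (α := ι))
      (k := Fintype.card ι / (36 * n)) (Nat.mul_div_le _ _) (fun i => (A (e i))ᶜ)
      (fun i => (hA _).1.compl) (fun i => ?_) fun x => ?_
    · have h1 := hψ.2.2 _ _ (hA (e i)).1 (hA (e i)).1.compl
      rw [union_compl_self, hnorm] at h1
      have h2 := h1.trans (add_le_add_left (hA (e i)).2 _)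
      rw [← NNReal.coe_le_coe] at h2 ⊢
      push_cast at h2 ⊢
      linarith
    · rw [Nat.le_div_iff_mul_le (by positivity)]
      have h1 := hx x
      have h2 : {i | x ∈ (A (e i))ᶜ}.ncard = {i | x ∉ A i}.ncard :=
        Set.ncard_preimage_of_injective_subset_range (s := {i | x ∉ A i}) e.injective
          (by simp [e.surjective.range_eq])
      rw [h2]
      rw [one_div_mul_eq_div, le_div_iff₀ (by positivity)] at h1
      exact_mod_cast h1
end

section
/- Let φ and ψ be normalized diffuse Maharam submeasures on the Borel subsets of Cantor space 2^ℕ and assume ψ is pathological. Then there is a Borel set C ⊆ 2^ℕ × 2^ℕ such that ψ(C_x) ≥ 1/3 for every x ∈ 2^ℕ and φ(C^y) = 0 for every y ∈ 2^ℕ, where C_x = {y : (x,y) ∈ C} and C^y = {x : (x,y) ∈ C}. -/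
open Set Filter NNReal

open MeasureTheory Topology

/-- The linear functional on formal nonnegative combinations of Borel sets given by evaluating the
corresponding combination of indicator functions at a point. -/
noncomputable def coverAt (y : Cantor) : ({A : Set Cantor // MeasurableSet A} →₀ ℝ≥0) →ₗ[ℝ≥0] ℝ :=
  Finsupp.linearCombination ℝ≥0 fun A => A.1.indicator (fun _ => (1 : ℝ)) y

/-- The cost, with respect to `ψ`, of a formal nonnegative combination of Borel sets. -/
noncomputable def coverCost (ψ : Set Cantor → ℝ≥0) :
    ({A : Set Cantor // MeasurableSet A} →₀ ℝ≥0) →ₗ[ℝ≥0] ℝ :=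
  Finsupp.linearCombination ℝ≥0 fun A => (ψ A.1 : ℝ)

/-- The cone of pairs `(f, t)` such that `f` is dominated by a combination of indicators of cost
at most `t`. -/
noncomputable def coverCone (ψ : Set Cantor → ℝ≥0) : PointedCone ℝ (SimpleFunc Cantor ℝ × ℝ) where
  carrier := {p | ∃ c, (∀ y, p.1 y ≤ coverAt y c) ∧ coverCost ψ c ≤ p.2}
  zero_mem' := ⟨0, by simp, by simp⟩
  add_mem' := by
    rintro p q ⟨c, hc, hc'⟩ ⟨d, hd, hd'⟩
    refine ⟨c + d, fun y => ?_, ?_⟩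
    · simpa using add_le_add (hc y) (hd y)
    · simpa using add_le_add hc' hd'
  smul_mem' := by
    rintro r p ⟨c, hc, hc'⟩
    refine ⟨(show ℝ≥0 from r) • c, fun y => ?_, ?_⟩
    · rw [map_smul]
      exact mul_le_mul_of_nonneg_left (hc y) r.2
    · rw [map_smul]
      exact mul_le_mul_of_nonneg_left hc' r.2

lemma coverCost_nonneg (ψ : Set Cantor → ℝ≥0) (c : {A : Set Cantor // MeasurableSet A} →₀ ℝ≥0) :
    0 ≤ coverCost ψ c := by
  rw [coverCost, Finsupp.linearCombination_apply]
  exact Finset.sum_nonneg fun A _ => by positivity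

/-- If every fractional cover by Borel sets is expensive, then there is a nonzero finitely additive
functional below `ψ`. -/
lemma exists_finAdd_of_le_coverCost {ψ : Set Cantor → ℝ≥0} {δ : ℝ} (hδ : 0 ≤ δ)
    (h : ∀ c, (∀ y, 1 ≤ coverAt y c) → δ ≤ coverCost ψ c) :
    ∃ ν : Set Cantor → ℝ≥0, FinAdd ν ∧ (∀ A, MeasurableSet A → ν A ≤ ψ A) ∧
      δ ≤ ν univ := by
  classical
  let x₀ : Cantor := fun _ => false
  let D : Submodule ℝ (SimpleFunc Cantor ℝ × ℝ) :=
    { carrier := {p | ∀ y, p.1 y = p.1 x₀}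
      zero_mem' := fun y => rfl
      add_mem' := fun {p q} hp hq y => by simp [hp y, hq y]
      smul_mem' := fun r p hp y => by simp [hp y] }
  let L : (SimpleFunc Cantor ℝ × ℝ) →ₗ[ℝ] ℝ :=
    { toFun := fun p => p.2 - δ * p.1 x₀
      map_add' := fun p q => by simp; ring
      map_smul' := fun r p => by simp; ring }
  obtain ⟨g, hg, hgs⟩ := riesz_extension (coverCone ψ) ⟨D, L.domRestrict D⟩ (by
    rintro ⟨p, hp⟩ ⟨c, hc, hc'⟩
    change 0 ≤ p.2 - δ * p.1 x₀
    simp only at hc hc'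
    have hp : ∀ y, p.1 y = p.1 x₀ := hp
    rcases le_or_gt (p.1 x₀) 0 with h0 | h0
    · have := coverCost_nonneg ψ c
      nlinarith [mul_nonneg hδ (neg_nonneg.2 h0)]
    · set r : ℝ≥0 := ⟨p.1 x₀, h0.le⟩ with hr
      have hr0 : 0 < (r : ℝ) := h0
      have h2 := h (r⁻¹ • c) fun y => by
        rw [map_smul, NNReal.smul_def, smul_eq_mul, NNReal.coe_inv, le_inv_mul_iff₀ hr0, mul_one]
        exact (hp y).symm.le.trans (hc y)
      rw [map_smul, NNReal.smul_def, smul_eq_mul, NNReal.coe_inv, le_inv_mul_iff₀ hr0] at h2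
      have : (r : ℝ) = p.1 x₀ := rfl
      rw [this] at h2
      linarith) (by
    rintro ⟨f, t⟩
    obtain ⟨C, hC⟩ := f.exists_forall_norm_le
    refine ⟨⟨(SimpleFunc.const _ (-C), -t), fun y => rfl⟩, 0, fun y => ?_, ?_⟩
    · have := (abs_le.1 (hC y)).2
      simpa using this
    · simp)
  let e : ∀ A : Set Cantor, MeasurableSet A → SimpleFunc Cantor ℝ := fun A hA =>
    SimpleFunc.piecewise A hA (SimpleFunc.const _ 1) (SimpleFunc.const _ 0)
  have he : ∀ A hA y, e A hA y = A.indicator (fun _ => (1 : ℝ)) y := fun A hA y => by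
    simp [e, Set.indicator, SimpleFunc.piecewise_apply]
  have h01 : g (0, 1) = 1 := by
    have := hg ⟨(0, 1), fun y => rfl⟩
    rw [this]
    change (1 : ℝ) - δ * 0 = 1
    simp
  have hnn : ∀ A hA, g (e A hA, 0) ≤ 0 := fun A hA => by
    have := hgs (-(e A hA), 0) ⟨0, fun y => by
      simp only [SimpleFunc.coe_neg, Pi.neg_apply, he, map_zero]
      exact neg_nonpos.2 (Set.indicator_nonneg (fun _ _ => zero_le_one) y), by simp⟩
    have h2 : (-(e A hA), (0 : ℝ)) = -(e A hA, (0 : ℝ)) := by ext <;> simp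
    rw [h2, map_neg] at this
    linarith
  have hle : ∀ A hA, -g (e A hA, 0) ≤ ψ A := fun A hA => by
    have := hgs (e A hA, ψ A) ⟨Finsupp.single ⟨A, hA⟩ 1, fun y => by
      simp [coverAt, he], by simp [coverCost]⟩
    have h2 : (e A hA, (ψ A : ℝ)) = (e A hA, (0 : ℝ)) + (ψ A : ℝ) • ((0 : SimpleFunc Cantor ℝ), (1 : ℝ)) := by
      ext <;> simp
    rw [h2, map_add, map_smul, h01] at this
    simp at this
    linarith
  refine ⟨fun A => if hA : MeasurableSet A then (-g (e A hA, 0)).toNNReal else 0, ⟨?_, ?_⟩, ?_, ?_⟩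
  · have : e ∅ MeasurableSet.empty = 0 := by ext y; simp [he]
    simp only [MeasurableSet.empty, dite_true, this, Prod.mk_zero_zero, map_zero, neg_zero,
      Real.toNNReal_zero]
  · intro A B hA hB hAB
    have : (e (A ∪ B) (hA.union hB), (0 : ℝ)) = (e A hA, 0) + (e B hB, 0) := by
      ext y
      · simp [he, Set.indicator_union_of_disjoint hAB]
      · simp
    simp only [hA, hB, hA.union hB, dite_true]
    rw [this, map_add, neg_add, Real.toNNReal_add] <;> linarith [hnn A hA, hnn B hB]
  · intro A hA
    simp only [hA, dite_true]
    exact Real.toNNReal_le_iff_le_coe.2 (hle A hA)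
  · simp only [MeasurableSet.univ, dite_true]
    rw [Real.coe_toNNReal _ (by linarith [hnn univ .univ])]
    have := hg ⟨(e univ .univ, 0), fun y => by simp [he]⟩
    rw [this]
    change δ ≤ -((0 : ℝ) - δ * e univ .univ x₀)
    simp [he]

/-- A pathological submeasure admits multiple covers that are cheap relative to their
multiplicity. -/
lemma exists_cheap_cover {ψ : Set Cantor → ℝ≥0}
    (hpath : ∀ ν : Set Cantor → ℝ≥0, FinAdd ν →
      (∀ A : Set Cantor, MeasurableSet A → ν A ≤ ψ A) →
      ∀ A : Set Cantor, MeasurableSet A → ν A = 0) {δ : ℝ} (hδ : 0 < δ) :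
    ∃ (I : Type) (_ : Fintype I) (A : I → Set Cantor) (k : ℕ), 0 < k ∧
      (∀ i, MeasurableSet (A i)) ∧ (∀ y, k ≤ Nat.card {i // y ∈ A i}) ∧
      ∑ i, (ψ (A i) : ℝ) ≤ δ * k := by
  obtain ⟨c, hc, hcδ⟩ : ∃ c, (∀ y, 1 ≤ coverAt y c) ∧ coverCost ψ c < δ := by
    by_contra! h
    obtain ⟨ν, h1, h2, h3⟩ := exists_finAdd_of_le_coverCost hδ.le h
    rw [hpath ν h1 h2 _ .univ] at h3
    exact absurd h3 (by simpa using hδ)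
  set S : ℝ := ∑ A ∈ c.support, (ψ A.1 : ℝ) with hS
  obtain ⟨Q, hQ⟩ := exists_nat_gt (S / (δ - coverCost ψ c))
  have hd : 0 < δ - coverCost ψ c := by linarith
  have hS0 : 0 ≤ S := Finset.sum_nonneg fun _ _ => by positivity
  have hQ0 : 0 < Q := by
    have : (0 : ℝ) < Q := (div_nonneg hS0 hd.le).trans_lt hQ
    exact_mod_cast this
  rw [div_lt_iff₀ hd] at hQ
  let e := c.support.equivFin
  let n : Fin c.support.card → ℕ := fun i => ⌈(c (e.symm i).1 * Q : ℝ≥0)⌉₊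
  refine ⟨Σ i, Fin (n i), inferInstance, fun i => (e.symm i.1).1.1, Q, hQ0,
    fun i => (e.symm i.1).1.2, fun y => ?_, ?_⟩
  · classical
    have hy := hc y
    rw [coverAt, Finsupp.linearCombination_apply, Finsupp.sum, ← Finset.sum_coe_sort,
      ← e.symm.sum_comp] at hy
    have h1 : Nat.card {i : Σ i, Fin (n i) // y ∈ (e.symm i.1).1.1} =
        ∑ i, if y ∈ (e.symm i).1.1 then n i else 0 := by
      rw [Nat.card_eq_fintype_card, Fintype.card_subtype, Finset.card_filter, Fintype.sum_sigma]
      refine Finset.sum_congr rfl fun i _ => ?_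
      split_ifs <;> simp [*]
    rw [h1]
    have h2 : (Q : ℝ) ≤ ((∑ i, if y ∈ (e.symm i).1.1 then n i else 0 : ℕ) : ℝ) := by
      push_cast
      calc (Q : ℝ) ≤ Q * _ := le_mul_of_one_le_right (by positivity) hy
        _ ≤ _ := by
          rw [Finset.mul_sum]
          refine Finset.sum_le_sum fun i _ => ?_
          by_cases hyi : y ∈ (e.symm i).1.1
          · have h3 : c (e.symm i).1 * Q ≤ n i := Nat.le_ceil _
            have h4 : (c (e.symm i).1 : ℝ) * Q ≤ n i := by exact_mod_cast h3
            simp only [hyi, Set.indicator_of_mem, if_true, NNReal.smul_def, smul_eq_mul]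
            linarith
          · simp [hyi]
    exact_mod_cast h2
  · rw [Fintype.sum_sigma]
    have h1 : ∀ i, ∑ _j : Fin (n i), (ψ (e.symm i).1.1 : ℝ) ≤
        Q * (c (e.symm i).1 * ψ (e.symm i).1.1) + ψ (e.symm i).1.1 := fun i => by
      have h3 : (n i : ℝ≥0) < c (e.symm i).1 * Q + 1 := Nat.ceil_lt_add_one (by positivity)
      have h4 : (n i : ℝ) ≤ c (e.symm i).1 * Q + 1 := by exact_mod_cast h3.le
      simp only [Finset.sum_const, Finset.card_univ, Fintype.card_fin, nsmul_eq_mul]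
      calc (n i : ℝ) * ψ (e.symm i).1.1 ≤ (c (e.symm i).1 * Q + 1) * ψ (e.symm i).1.1 := by gcongr
        _ = _ := by ring
    refine (Finset.sum_le_sum fun i _ => h1 i).trans ?_
    rw [Finset.sum_add_distrib, ← Finset.mul_sum,
      e.symm.sum_comp (fun A : c.support => (c A.1 : ℝ) * ψ A.1.1),
      e.symm.sum_comp (fun A : c.support => (ψ A.1.1 : ℝ)),
      Finset.sum_coe_sort c.support (fun A => (c A : ℝ) * ψ A.1),
      Finset.sum_coe_sort c.support (fun A => (ψ A.1 : ℝ)), ← hS]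
    have h5 : ∑ A ∈ c.support, (c A : ℝ) * ψ A.1 = coverCost ψ c := by
      rw [coverCost, Finsupp.linearCombination_apply]
      rfl
    rw [h5]
    linarith

/-- Every large enough random bipartite graph of left degree three expands small sets. -/
lemma exists_concentrator {M L : Type*} [Fintype M] [Fintype L] [DecidableEq L] {k : ℕ}
    (hL : 0 < Fintype.card L) (hkL : k ≤ Fintype.card L)
    (h : 27 * Fintype.card M * k ≤ Fintype.card L ^ 2) :
    ∃ f : M → Fin 3 → L, ∀ E : Finset M, E.card ≤ k →
      E.card ≤ (E.biUnion fun x => Finset.univ.image (f x)).card := by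
  classical
  by_contra! hcon
  set m := Fintype.card M
  set l := Fintype.card L
  let G : Finset M → Finset L → Finset (M → Fin 3 → L) := fun E F =>
    Fintype.piFinset fun x => if x ∈ E then Fintype.piFinset fun _ => F else Finset.univ
  have hGcard : ∀ j, ∀ E ∈ Finset.powersetCard j (Finset.univ : Finset M),
      ∀ F ∈ Finset.powersetCard j (Finset.univ : Finset L),
      (G E F).card * (l ^ 3) ^ j = (j ^ 3) ^ j * (l ^ 3) ^ m := fun j E hE F hF => by
    have hE := (Finset.mem_powersetCard.1 hE).2
    have hF := (Finset.mem_powersetCard.1 hF).2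
    have hjm : j ≤ m := hE ▸ Finset.card_le_univ E
    simp only [G, Fintype.card_piFinset]
    have : ∀ x, (if x ∈ E then Fintype.piFinset fun _ : Fin 3 => F else Finset.univ).card =
        if x ∈ E then j ^ 3 else l ^ 3 := fun x => by
      split_ifs <;> simp [hF, l]
    simp only [this]
    rw [Finset.prod_ite, Finset.prod_const, Finset.prod_const]
    have h1 : (Finset.univ.filter (· ∈ E)).card = j := by simp [hE]
    have h2 : (Finset.univ.filter (¬ · ∈ E)).card = m - j := by
      rw [Finset.filter_not, Finset.card_sdiff_of_subset (Finset.filter_subset _ _), h1]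
      simp [m]
    rw [h1, h2, mul_assoc, ← pow_add, Nat.sub_add_cancel hjm]
  have hcover : (Finset.univ : Finset (M → Fin 3 → L)) ⊆
      (Finset.Icc 1 k).biUnion fun j => (Finset.powersetCard j Finset.univ).biUnion fun E =>
        (Finset.powersetCard j Finset.univ).biUnion fun F => G E F := fun f _ => by
    obtain ⟨E, hEk, hE⟩ := hcon f
    obtain ⟨F, hF1, -, hF2⟩ := Finset.exists_subsuperset_card_eq (Finset.subset_univ _) hE.le
      (show E.card ≤ (Finset.univ : Finset L).card from hEk.trans (by simpa using hkL))
    simp only [Finset.mem_biUnion, Finset.mem_powersetCard, Finset.mem_Icc]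
    refine ⟨E.card, ⟨by omega, hEk⟩, E, ⟨Finset.subset_univ _, rfl⟩, F,
      ⟨Finset.subset_univ _, hF2⟩, ?_⟩
    simp only [G, Fintype.mem_piFinset]
    intro x
    split_ifs with hx
    · rw [Fintype.mem_piFinset]
      exact fun i => hF1 (Finset.mem_biUnion.2 ⟨x, hx, Finset.mem_image_of_mem _ (Finset.mem_univ i)⟩)
    · exact Finset.mem_univ _
  have hl : (0 : ℝ) < l := by exact_mod_cast hL
  have hterm : ∀ j ∈ Finset.Icc 1 k,
      (((Finset.powersetCard j Finset.univ).biUnion fun E =>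
        (Finset.powersetCard j Finset.univ).biUnion fun F => G E F).card : ℝ) ≤
        (1 / 3) ^ j * (l ^ 3) ^ m := fun j hj => by
    have hjk : j ≤ k := (Finset.mem_Icc.1 hj).2
    have hfac : (j : ℝ) ^ j ≤ 3 ^ j * j.factorial := by
      have h1 := Real.pow_div_factorial_le_exp (j : ℝ) (Nat.cast_nonneg j) j
      rw [div_le_iff₀ (by positivity)] at h1
      refine h1.trans ?_
      gcongr
      rw [← Real.exp_one_pow]
      gcongr
      exact (Real.exp_one_lt_d9.trans (by norm_num)).le
    have hch : ∀ n : ℕ, (n.choose j : ℝ) * j ^ j ≤ (3 * n) ^ j := fun n => by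
      have h1 := Nat.choose_le_pow_div (α := ℝ) j n
      rw [le_div_iff₀ (by positivity)] at h1
      calc (n.choose j : ℝ) * j ^ j ≤ n.choose j * (3 ^ j * j.factorial) := by gcongr
        _ = 3 ^ j * (n.choose j * j.factorial) := by ring
        _ ≤ 3 ^ j * n ^ j := by gcongr
        _ = _ := by rw [mul_pow]
    have hG : ∀ E ∈ Finset.powersetCard j (Finset.univ : Finset M),
      ∀ F ∈ Finset.powersetCard j (Finset.univ : Finset L),
      ((G E F).card : ℝ) ≤ (j ^ 3) ^ j * (l ^ 3) ^ m / (l ^ 3) ^ j := fun E hE F hF => by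
      rw [le_div_iff₀ (by positivity)]
      exact_mod_cast (hGcard j E hE F hF).le
    calc _ ≤ ((∑ E ∈ Finset.powersetCard j (Finset.univ : Finset M),
          ∑ F ∈ Finset.powersetCard j (Finset.univ : Finset L), (G E F).card : ℕ) : ℝ) := by
          exact_mod_cast Finset.card_biUnion_le.trans
            (Finset.sum_le_sum fun E _ => Finset.card_biUnion_le)
      _ ≤ ∑ E ∈ Finset.powersetCard j (Finset.univ : Finset M),
          ∑ F ∈ Finset.powersetCard j (Finset.univ : Finset L),
            ((j : ℝ) ^ 3) ^ j * (l ^ 3) ^ m / (l ^ 3) ^ j := by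
          push_cast
          exact Finset.sum_le_sum fun E hE => Finset.sum_le_sum fun F hF => hG E hE F hF
      _ = ((m.choose j : ℝ) * j ^ j) * ((l.choose j : ℝ) * j ^ j) * j ^ j *
            ((l ^ 3) ^ m / (l ^ 3) ^ j) := by
          simp only [Finset.sum_const, Finset.card_powersetCard, Finset.card_univ, nsmul_eq_mul]
          ring
      _ ≤ (3 * m) ^ j * (3 * l) ^ j * j ^ j * ((l ^ 3) ^ m / (l ^ 3) ^ j) := by
          gcongr <;> exact hch _
      _ = (9 * m * j * l) ^ j * ((l ^ 3) ^ m / (l ^ 3) ^ j) := by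
          rw [← mul_pow, ← mul_pow]; ring
      _ ≤ (1 / 3 * l ^ 3) ^ j * ((l ^ 3) ^ m / (l ^ 3) ^ j) := by
          have h1 : (27 : ℝ) * m * k ≤ l ^ 2 := by exact_mod_cast h
          have h2 : (m : ℝ) * j ≤ m * k := by gcongr
          have h3 : 9 * (m : ℝ) * j * l ≤ 1 / 3 * l ^ 3 := by nlinarith
          gcongr
      _ = _ := by
          rw [mul_pow]
          field_simp
  have hgeom : ∀ k : ℕ, ∑ j ∈ Finset.Icc 1 k, (1 / 3 : ℝ) ^ j < 1 := fun k => by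
    have : ∑ j ∈ Finset.Icc 1 k, (1 / 3 : ℝ) ^ j = (1 - (1 / 3) ^ k) / 2 := by
      induction k with
      | zero => simp
      | succ k ih => rw [Finset.sum_Icc_succ_top (by omega), ih]; ring
    rw [this]
    have : (0 : ℝ) < (1 / 3) ^ k := by positivity
    linarith
  have htotal : ((l : ℝ) ^ 3) ^ m ≤ (∑ j ∈ Finset.Icc 1 k, (1 / 3 : ℝ) ^ j) * (l ^ 3) ^ m := by
    have h1 := (Finset.card_le_card hcover).trans Finset.card_biUnion_le
    rw [Finset.card_univ, Fintype.card_fun, Fintype.card_fun, Fintype.card_fin] at h1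
    rw [Finset.sum_mul]
    refine le_trans ?_ (Finset.sum_le_sum hterm)
    exact_mod_cast h1
  have hpos : (0 : ℝ) < (l ^ 3) ^ m := by positivity
  nlinarith [hgeom k]

/-- A version of `exists_concentrator` in terms of injective selections. -/
lemma exists_injective_selections {M L : Type*} [Fintype M] [Fintype L] {k : ℕ}
    (hL : 0 < Fintype.card L) (hkL : k ≤ Fintype.card L)
    (h : 27 * Fintype.card M * k ≤ Fintype.card L ^ 2) :
    ∃ (f : M → Fin 3 → L) (s : Finset M → M → Fin 3), ∀ E : Finset M, E.card ≤ k →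
      Set.InjOn (fun x => f x (s E x)) E := by
  classical
  obtain ⟨f, hf⟩ := exists_concentrator (M := M) hL hkL h
  have key : ∀ E : Finset M, ∃ s : M → Fin 3, E.card ≤ k → Set.InjOn (fun x => f x (s x)) E := by
    intro E
    by_cases hE : E.card ≤ k
    · obtain ⟨g, hg, hgf⟩ := (Finset.all_card_le_biUnion_card_iff_exists_injective
        (fun x : E => Finset.univ.image (f x))).1 fun S => by
          have h1 : (S.map (Function.Embedding.subtype _)).card ≤ k :=
            (Finset.card_le_card fun x hx => by
              obtain ⟨y, -, rfl⟩ := Finset.mem_map.1 hx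
              exact y.2).trans hE
          have h2 := hf _ h1
          rwa [Finset.card_map, Finset.map_eq_image, Finset.image_biUnion] at h2
      have hgf' : ∀ x : E, ∃ j, f x j = g x := fun x => by simpa using hgf x
      choose j hj using hgf'
      refine ⟨fun x => if hx : x ∈ E then j ⟨x, hx⟩ else 0, fun _ x hx y hy hxy => ?_⟩
      have hx' : x ∈ E := hx
      have hy' : y ∈ E := hy
      simp only [hx', hy', dite_true] at hxy
      rw [hj ⟨x, hx'⟩, hj ⟨y, hy'⟩] at hxy
      exact congrArg Subtype.val (hg hxy)
    · exact ⟨fun _ => 0, fun h => absurd h hE⟩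
  choose s hs using key
  exact ⟨f, s, hs⟩

lemma Submeasure.biUnion_le {ψ : Set Cantor → ℝ≥0} (hψ : Submeasure ψ) {ι : Type*}
    {A : ι → Set Cantor} (hA : ∀ i, MeasurableSet (A i)) (s : Finset ι) :
    ψ (⋃ i ∈ s, A i) ≤ ∑ i ∈ s, ψ (A i) := by
  classical
  induction s using Finset.induction_on with
  | empty => simp [hψ.1]
  | insert i s hi ih =>
    rw [Finset.set_biUnion_insert, Finset.sum_insert hi]
    exact (hψ.2.2 _ _ (hA i) (s.measurableSet_biUnion fun i _ => hA i)).trans (by gcongr)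

lemma Submeasure.iUnion_le {ψ : Set Cantor → ℝ≥0} (hψ : Submeasure ψ) {ι : Type*} [Fintype ι]
    {A : ι → Set Cantor} (hA : ∀ i, MeasurableSet (A i)) :
    ψ (⋃ i, A i) ≤ ∑ i, ψ (A i) := by
  simpa using hψ.biUnion_le hA Finset.univ

/-- A normalized pathological submeasure admits a finite family of sets of submeasure almost one
such that each point belongs to a small proportion of them. -/
lemma exists_thin_family {ψ : Set Cantor → ℝ≥0} (hψ : Submeasure ψ) (hψn : ψ univ = 1)
    (hpath : ∀ ν : Set Cantor → ℝ≥0, FinAdd ν →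
      (∀ A : Set Cantor, MeasurableSet A → ν A ≤ ψ A) →
      ∀ A : Set Cantor, MeasurableSet A → ν A = 0) {ε η : ℝ} (hε : 0 < ε) (hη : 0 < η) :
    ∃ (I : Type) (_ : Fintype I) (a : I → Set Cantor), Nonempty I ∧
      (∀ i, MeasurableSet (a i)) ∧ (∀ i, 1 - ε ≤ ψ (a i)) ∧
      ∀ y, (Nat.card {i // y ∈ a i} : ℝ) ≤ η * Fintype.card I := by
  classical
  obtain ⟨n, hn⟩ := exists_pow_lt_of_lt_one (half_pos hη) 
    (Real.exp_lt_one_iff.2 (show (-1 : ℝ) < 0 by norm_num))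
  obtain ⟨I, _, A, k, hk, hA, hcov, hcost⟩ :=
    exists_cheap_cover hpath (δ := ε * η / (4 * (n + 1))) (by positivity)
  set m := Fintype.card I with hm
  have hkm : k ≤ m := by
    refine (hcov fun _ => false).trans ?_
    rw [Nat.card_eq_fintype_card]
    exact Fintype.card_subtype_le _
  have hm0 : 0 < m := hk.trans_le hkm
  have hI : Nonempty I := Fintype.card_pos_iff.1 hm0
  set q := m / k + 1 with hq
  have hq1 : m ≤ q * k := by
    have := Nat.lt_div_mul_add (a := m) hk
    rw [hq, add_mul, one_mul]
    omega
  have hq2 : q * k ≤ 2 * m := by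
    have := Nat.div_mul_le_self m k
    rw [hq, add_mul, one_mul]
    omega
  set T := n * q with hT
  let b : (Fin T → I) → Set Cantor := fun s => ⋃ t, A (s t)
  have hb : ∀ s, MeasurableSet (b s) := fun s => MeasurableSet.iUnion fun t => hA _
  have hmR : (0 : ℝ) < m := by exact_mod_cast hm0
  have hcardT : (Fintype.card (Fin T → I) : ℝ) = m ^ T := by simp [hm]
  have hmiss : ∀ y, ((Finset.univ.filter fun s => y ∉ b s).card : ℝ) ≤ η / 2 * m ^ T := fun y => by
    have h1 : (Finset.univ.filter fun s => y ∉ b s) =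
        Fintype.piFinset fun _ => Finset.univ.filter fun i => y ∉ A i := by
      ext s
      simp [b, Fintype.mem_piFinset]
    have h2 : ((Finset.univ.filter fun i => y ∉ A i).card : ℝ) ≤ m * (1 - k / m) := by
      have h3 := hcov y
      rw [Nat.card_eq_fintype_card, Fintype.card_subtype] at h3
      have h4 := Finset.card_filter_add_card_filter_not (s := (Finset.univ : Finset I))
        (fun i => y ∈ A i)
      rw [Finset.card_univ] at h4
      have h5 : k + (Finset.univ.filter fun i => y ∉ A i).card ≤ m := by omega
      have h6 : (k : ℝ) + (Finset.univ.filter fun i => y ∉ A i).card ≤ m := by exact_mod_cast h5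
      rw [mul_sub, mul_div_cancel₀ _ hmR.ne']
      linarith
    have h3 : (1 - (k : ℝ) / m) ^ T ≤ η / 2 := by
      have h0 : 0 ≤ 1 - (k : ℝ) / m := by
        rw [sub_nonneg, div_le_one hmR]
        exact_mod_cast hkm
      have h4 : (1 - (k : ℝ) / m) ^ q ≤ Real.exp (-1) := by
        refine (pow_le_pow_left₀ h0 (Real.one_sub_le_exp_neg _) q).trans ?_
        rw [← Real.exp_nat_mul, Real.exp_le_exp]
        have : (1 : ℝ) ≤ q * (k / m) := by
          rw [← mul_div_assoc, one_le_div hmR]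
          exact_mod_cast hq1
        linarith
      rw [hT, mul_comm, pow_mul]
      exact (pow_le_pow_left₀ (by positivity) h4 n).trans hn.le
    rw [h1, Fintype.card_piFinset, Finset.prod_const, Finset.card_univ, Fintype.card_fin]
    push_cast
    calc _ ≤ ((m : ℝ) * (1 - k / m)) ^ T := by gcongr
      _ = (1 - (k : ℝ) / m) ^ T * m ^ T := by rw [mul_pow, mul_comm]
      _ ≤ _ := by gcongr
  have hbad : ((Finset.univ.filter fun s => ε < ψ (b s)).card : ℝ) ≤ η / 2 * m ^ T := by
    have h1 : ε * (Finset.univ.filter fun s => ε < ψ (b s)).card ≤ ∑ s, (ψ (b s) : ℝ) := by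
      rw [mul_comm, ← nsmul_eq_mul]
      refine (Finset.card_nsmul_le_sum _ (fun s => (ψ (b s) : ℝ)) ε fun s hs =>
        (Finset.mem_filter.1 hs).2.le).trans ?_
      exact Finset.sum_le_sum_of_subset_of_nonneg (Finset.filter_subset _ _) fun _ _ _ => by positivity
    have h2 : ∑ s, (ψ (b s) : ℝ) ≤ ∑ s : Fin T → I, ∑ t, (ψ (A (s t)) : ℝ) :=
      Finset.sum_le_sum fun s _ => by exact_mod_cast hψ.iUnion_le fun t => hA (s t)
    have h3 : ∀ t : Fin T, ∑ s : Fin T → I, (ψ (A (s t)) : ℝ) = m ^ (T - 1) * ∑ i, (ψ (A i) : ℝ) := by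
      intro t
      have := Fintype.sum_piFinset_apply (fun i => (ψ (A i) : ℝ)) Finset.univ t
      rw [Fintype.piFinset_univ] at this
      rw [this]
      simp [hm]
    rw [Finset.sum_comm] at h2
    simp only [h3, Finset.sum_const, Finset.card_univ, Fintype.card_fin, nsmul_eq_mul] at h2
    have h4 : (T : ℝ) * (m ^ (T - 1) * ∑ i, (ψ (A i) : ℝ)) ≤ ε * (η / 2 * m ^ T) := by
      rcases Nat.eq_zero_or_pos T with h0 | h0
      · rw [h0]; simp; positivity
      · have h5 : (m : ℝ) ^ T = m ^ (T - 1) * m := by rw [← pow_succ, Nat.sub_add_cancel h0]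
        have h6 : (q : ℝ) * k ≤ 2 * m := by exact_mod_cast hq2
        have h7 : (T : ℝ) = n * q := by rw [hT]; push_cast; ring
        calc (T : ℝ) * (m ^ (T - 1) * ∑ i, (ψ (A i) : ℝ))
            ≤ T * (m ^ (T - 1) * (ε * η / (4 * (n + 1)) * k)) := by gcongr
          _ = m ^ (T - 1) * (ε * η / (4 * (n + 1))) * n * (q * k) := by rw [h7]; ring
          _ ≤ m ^ (T - 1) * (ε * η / (4 * (n + 1))) * (n + 1) * (2 * m) := by
            gcongr
            linarith
          _ = ε * (η / 2 * m ^ T) := by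
            rw [h5]
            field_simp
            ring
    exact le_of_mul_le_mul_left (h1.trans (h2.trans h4)) hε
  refine ⟨Fin T → I, inferInstance, fun s => if (ψ (b s) : ℝ) ≤ ε then (b s)ᶜ else univ,
    inferInstance, fun s => ?_, fun s => ?_, fun y => ?_⟩
  · dsimp only
    split_ifs
    · exact (hb s).compl
    · exact .univ
  · dsimp only
    split_ifs with h
    · have h1 := hψ.2.2 _ _ (hb s) (hb s).compl
      rw [union_compl_self, hψn] at h1
      have h2 : (1 : ℝ) ≤ ψ (b s) + ψ (b s)ᶜ := by exact_mod_cast h1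
      linarith
    · rw [hψn]
      push_cast
      linarith
  · rw [Nat.card_eq_fintype_card, Fintype.card_subtype, hcardT]
    have h1 : (Finset.univ.filter fun s => y ∈ if (ψ (b s) : ℝ) ≤ ε then (b s)ᶜ else univ) ⊆
        (Finset.univ.filter fun s => y ∉ b s) ∪ (Finset.univ.filter fun s => ε < ψ (b s)) := by
      intro s hs
      simp only [Finset.mem_union, Finset.mem_filter, Finset.mem_univ, true_and] at hs ⊢
      split_ifs at hs with h
      · exact Or.inl hs
      · exact Or.inr (not_le.1 h)
    have h2 := (Finset.card_le_card h1).trans (Finset.card_union_le _ _)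
    have h3 : ((Finset.univ.filter fun s =>
        y ∈ if (ψ (b s) : ℝ) ≤ ε then (b s)ᶜ else univ).card : ℝ) ≤
        (Finset.univ.filter fun s => y ∉ b s).card +
        (Finset.univ.filter fun s => ε < ψ (b s)).card := by exact_mod_cast h2
    linarith [hmiss y]

/-- A normalized pathological submeasure admits arbitrarily many pairwise disjoint sets of
submeasure almost `1 / 3`. -/
lemma exists_disjoint_family {ψ : Set Cantor → ℝ≥0} (hψ : Submeasure ψ) (hψn : ψ univ = 1)
    (hpath : ∀ ν : Set Cantor → ℝ≥0, FinAdd ν →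
      (∀ A : Set Cantor, MeasurableSet A → ν A ≤ ψ A) →
      ∀ A : Set Cantor, MeasurableSet A → ν A = 0) {ε : ℝ} (hε : 0 < ε) {N : ℕ} (hN : 0 < N) :
    ∃ B : Fin N → Set Cantor, (∀ i, MeasurableSet (B i)) ∧ (∀ i j, i ≠ j → Disjoint (B i) (B j)) ∧
      ∀ i, (1 - ε) / 3 ≤ ψ (B i) := by
  classical
  have hNR : (0 : ℝ) < N := by exact_mod_cast hN
  obtain ⟨I, _, a, hI, ha, haψ, hthin⟩ :=
    exists_thin_family hψ hψn hpath hε (η := 1 / (27 * (N : ℝ) ^ 2)) (by positivity)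
  set l := Fintype.card I with hl
  have hcard : Fintype.card (I × Fin N) = l * N := by simp [hl]
  obtain ⟨f, s, hs⟩ := exists_injective_selections (M := I × Fin N) (L := I) (k := l / (27 * N))
    Fintype.card_pos (Nat.div_le_self _ _) (by
      rw [hcard, ← hl]
      calc 27 * (l * N) * (l / (27 * N)) = l * (l / (27 * N) * (27 * N)) := by ring
        _ ≤ l * l := Nat.mul_le_mul_left _ (Nat.div_mul_le_self _ _)
        _ = l ^ 2 := (sq l).symm)
  let E : Cantor → Finset (I × Fin N) := fun z => Finset.univ.filter fun x => z ∈ a x.1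
  have hE : ∀ z, (E z).card ≤ l / (27 * N) := fun z => by
    have h1 : (E z).card = Nat.card {i // z ∈ a i} * N := by
      rw [Nat.card_eq_fintype_card, Fintype.card_subtype]
      have : E z = (Finset.univ.filter fun i => z ∈ a i) ×ˢ Finset.univ := by
        ext x; simp [E]
      rw [this, Finset.card_product, Finset.card_univ, Fintype.card_fin]
    rw [Nat.le_div_iff_mul_le (by positivity), h1]
    have h2 := hthin z
    rw [div_mul_eq_mul_div, one_mul, le_div_iff₀ (by positivity)] at h2
    have h3 : (Nat.card {i // z ∈ a i} * N * (27 * N) : ℝ) ≤ l := by linarith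
    exact_mod_cast h3
  have hEmeas : ∀ P : Finset (I × Fin N) → Prop, MeasurableSet {z | P (E z)} := fun P => by
    have h1 : {z | P (E z)} = ⋃ S, ⋃ _ : P S, ⋂ x, {z | x ∈ S ↔ z ∈ a x.1} := by
      ext z
      simp only [mem_ofPred_eq, mem_iUnion, mem_iInter, exists_prop]
      constructor
      · exact fun h => ⟨E z, h, fun x => by simp [E]⟩
      · rintro ⟨S, hS, h⟩
        have : S = E z := by ext x; simp [E, h x]
        rwa [← this]
    rw [h1]
    refine .iUnion fun S => .iUnion fun _ => .iInter fun x => ?_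
    by_cases hx : x ∈ S
    · simpa [hx] using ha x.1
    · have h2 : {z | x ∈ S ↔ z ∈ a x.1} = (a x.1)ᶜ := by ext z; simp [hx]
      rw [h2]
      exact (ha x.1).compl
  let c : I × Fin N → Fin 3 → Set Cantor := fun x j => a x.1 ∩ {z | s (E z) x = j}
  have hc : ∀ x j, MeasurableSet (c x j) := fun x j =>
    (ha x.1).inter (hEmeas fun S => s S x = j)
  have hex : ∀ x, ∃ j, (1 - ε) / 3 ≤ ψ (c x j) := fun x => by
    by_contra! h
    have h1 : a x.1 = ⋃ j, c x j := by
      ext z; simp [c]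
    have h2 := hψ.iUnion_le (hc x)
    rw [← h1, Fin.sum_univ_three] at h2
    have h3 : (ψ (a x.1) : ℝ) ≤ ψ (c x 0) + ψ (c x 1) + ψ (c x 2) := by exact_mod_cast h2
    linarith [haψ x.1, h 0, h 1, h 2]
  choose j hj using hex
  obtain ⟨y, hy⟩ := Fintype.exists_le_card_fiber_of_mul_le_card (fun x => f x (j x)) (n := N)
    hcard.ge
  obtain ⟨S, hSsub, hS⟩ := Finset.exists_subset_card_eq hy
  let e := S.equivFinOfCardEq hS
  refine ⟨fun i => c (e.symm i) (j (e.symm i)), fun i => hc _ _, fun i i' hii' => ?_,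
    fun i => hj _⟩
  rw [Set.disjoint_left]
  rintro z ⟨hz1, hz2⟩ ⟨hz1', hz2'⟩
  have hmem : ∀ i, f (e.symm i) (j (e.symm i)) = y := fun i =>
    (Finset.mem_filter.1 (hSsub (e.symm i).2)).2
  simp only [mem_ofPred_eq] at hz2 hz2'
  have h1 := hs (E z) (hE z) (x₁ := (e.symm i).1) (x₂ := (e.symm i').1)
    (by simpa [E] using hz1) (by simpa [E] using hz1') (by
      simp only [hz2, hz2', hmem])
  exact hii' (e.symm.injective (Subtype.ext h1))

/-- A Maharam submeasure is countably subadditive. -/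
lemma Maharam.iUnion_le {φ : Set Cantor → ℝ≥0} (hφ : Maharam φ) {D : ℕ → Set Cantor}
    (hD : ∀ n, MeasurableSet (D n)) {r : ℝ≥0} (hr : ∀ n, ∑ i ∈ Finset.range n, φ (D i) ≤ r) :
    φ (⋃ n, D n) ≤ r := by
  let P : ℕ → Set Cantor := fun n => ⋃ i ∈ Finset.range n, D i
  have hP : ∀ n, MeasurableSet (P n) := fun n => Finset.measurableSet_biUnion _ fun i _ => hD i
  have hU : MeasurableSet (⋃ n, D n) := .iUnion hD
  have hlim := hφ.2 (fun n => (⋃ n, D n) \ P n) (fun n => hU.diff (hP n)) fun i j hij =>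
    sdiff_subset_sdiff_right (biUnion_subset_biUnion_left fun x hx => by
      simp only [Finset.coe_range, mem_Iio] at hx ⊢
      omega)
  have hempty : ⋂ n, (⋃ n, D n) \ P n = ∅ := by
    refine eq_empty_of_forall_notMem fun x hx => ?_
    rw [mem_iInter] at hx
    obtain ⟨n, hn⟩ := mem_iUnion.1 (hx 0).1
    exact (hx (n + 1)).2 (mem_biUnion (by simp) hn)
  rw [hempty, hφ.1.1] at hlim
  have hle : ∀ n, φ (⋃ n, D n) ≤ r + φ ((⋃ n, D n) \ P n) := fun n => by
    have h1 : ⋃ n, D n ⊆ P n ∪ ((⋃ n, D n) \ P n) := fun x hx => by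
      by_cases h : x ∈ P n
      · exact Or.inl h
      · exact Or.inr ⟨hx, h⟩
    refine (hφ.1.2.1 _ _ hU ((hP n).union (hU.diff (hP n))) h1).trans
      ((hφ.1.2.2 _ _ (hP n) (hU.diff (hP n))).trans ?_)
    gcongr
    exact (hφ.1.biUnion_le hD _).trans (hr n)
  simpa using ge_of_tendsto (hlim.const_add r) (.of_forall hle)

/-- For a diffuse Maharam submeasure, cylinders of sufficiently large length are uniformly small. -/
lemma Maharam.exists_cylinder_le {φ : Set Cantor → ℝ≥0} (hφ : Maharam φ) (hφd : Diffuse φ)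
    {ε : ℝ≥0} (hε : 0 < ε) : ∃ d : ℕ, ∀ x : Cantor, φ (PiNat.cylinder x d) ≤ ε := by
  have hmeas : ∀ (x : Cantor) n, MeasurableSet (PiNat.cylinder x n) := fun x n =>
    (PiNat.isOpen_cylinder _ x n).measurableSet
  have hx : ∀ x : Cantor, ∃ n, φ (PiNat.cylinder x n) < ε := fun x => by
    have hlim := hφ.2 (fun n => PiNat.cylinder x n) (hmeas x) fun i j hij =>
      PiNat.cylinder_anti x hij
    have hsing : ⋂ n, PiNat.cylinder x n = {x} := by
      ext y
      simp only [mem_iInter, PiNat.mem_cylinder_iff, mem_singleton_iff]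
      exact ⟨fun h => funext fun i => h (i + 1) i (Nat.lt_succ_self i), fun h n i _ => by rw [h]⟩
    rw [hsing, hφd x] at hlim
    exact (hlim.eventually_lt_const hε).exists
  choose n hn using hx
  obtain ⟨t, ht⟩ := isCompact_univ.elim_finite_subcover (fun x : Cantor => PiNat.cylinder x (n x))
    (fun x => PiNat.isOpen_cylinder _ x (n x))
    fun x _ => mem_iUnion.2 ⟨x, PiNat.self_mem_cylinder x (n x)⟩
  refine ⟨t.sup n, fun x => ?_⟩
  obtain ⟨y, hy, hxy⟩ := mem_iUnion₂.1 (ht (mem_univ x))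
  refine (hφ.1.2.1 _ _ (hmeas _ _) (hmeas _ _) ?_).trans (hn y).le
  rw [← PiNat.mem_cylinder_iff_eq.1 hxy]
  exact PiNat.cylinder_anti x (Finset.le_sup hy)

/-- A Borel set in the product with `ψ`-large vertical sections and `φ`-small horizontal ones. -/
lemma exists_large_small_sections {φ ψ : Set Cantor → ℝ≥0} (hφ : Maharam φ) (hφd : Diffuse φ)
    (hψ : Submeasure ψ) (hψn : ψ univ = 1)
    (hpath : ∀ ν : Set Cantor → ℝ≥0, FinAdd ν →
      (∀ A : Set Cantor, MeasurableSet A → ν A ≤ ψ A) →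
      ∀ A : Set Cantor, MeasurableSet A → ν A = 0) {ε : ℝ≥0} (hε : 0 < ε) :
    ∃ C : Set (Cantor × Cantor), MeasurableSet C ∧
      (∀ x, (1 - (ε : ℝ)) / 3 ≤ ψ {y | (x, y) ∈ C}) ∧ ∀ y, φ {x | (x, y) ∈ C} ≤ ε := by
  obtain ⟨d, hd⟩ := hφ.exists_cylinder_le hφd hε
  let e := Fintype.equivFin (Fin d → Bool)
  obtain ⟨B, hB, hdisj, hBψ⟩ := exists_disjoint_family hψ hψn hpath (ε := ε) (by exact_mod_cast hε)
    (N := Fintype.card (Fin d → Bool)) Fintype.card_pos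
  let p : Cantor → Fin d → Bool := fun x i => x i
  have hp : Measurable p := by fun_prop
  refine ⟨⋃ s, (p ⁻¹' {s}) ×ˢ B (e s),
    .iUnion fun s => (hp (measurableSet_singleton s)).prod (hB _), fun x => ?_, fun y => ?_⟩
  · have : {y | (x, y) ∈ ⋃ s, (p ⁻¹' {s}) ×ˢ B (e s)} = B (e (p x)) := by
      ext y; simp
    rw [this]
    exact hBψ _
  · by_cases h : ∃ s, y ∈ B (e s)
    · obtain ⟨s, hs⟩ := h
      let x₀ : Cantor := fun i => if h : i < d then s ⟨i, h⟩ else false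
      have : {x | (x, y) ∈ ⋃ s, (p ⁻¹' {s}) ×ˢ B (e s)} = PiNat.cylinder x₀ d := by
        ext x
        simp only [mem_ofPred_eq, mem_iUnion, mem_prod, mem_preimage, mem_singleton_iff,
          PiNat.mem_cylinder_iff]
        constructor
        · rintro ⟨s', rfl, hs'⟩ i hi
          have : s = p x := by
            by_contra hne
            exact disjoint_left.1 (hdisj _ _ (e.injective.ne hne)) hs hs'
          simp [x₀, hi, this, p]
        · intro h
          refine ⟨s, funext fun i => ?_, hs⟩
          simpa [x₀, p] using h i i.2
      rw [this]
      exact hd x₀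
    · have : {x | (x, y) ∈ ⋃ s, (p ⁻¹' {s}) ×ˢ B (e s)} = ∅ := by
        ext x
        simp only [mem_ofPred_eq, mem_iUnion, mem_prod, mem_empty_iff_false, iff_false]
        rintro ⟨s, -, hs⟩
        exact h ⟨s, hs⟩
      rw [this, hφ.1.1]
      exact zero_le

/-- If `φ, ψ` are normalized diffuse Maharam submeasures and `ψ` is
pathological, then there is a Borel `C ⊆ 2^ℕ × 2^ℕ` with `ψ(C_x) ≥ 1/3` for
all `x` and `φ(C^y) = 0` for all `y`. -/
theorem stmt10 (φ ψ : Set Cantor → ℝ≥0)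
    (hφ : Maharam φ) (hφd : Diffuse φ) (hφn : φ univ = 1)
    (hψ : Maharam ψ) (hψd : Diffuse ψ) (hψn : ψ univ = 1)
    (hpath : ∀ ν : Set Cantor → ℝ≥0, FinAdd ν →
      (∀ A : Set Cantor, MeasurableSet A → ν A ≤ ψ A) →
      ∀ A : Set Cantor, MeasurableSet A → ν A = 0) :
    ∃ C : Set (Cantor × Cantor), MeasurableSet C ∧
      (∀ x : Cantor, (1/3 : ℝ≥0) ≤ ψ {y | (x, y) ∈ C}) ∧
      (∀ y : Cantor, φ {x | (x, y) ∈ C} = 0) := by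

  choose C hC hCψ hCφ using fun n : ℕ => exists_large_small_sections hφ hφd hψ.1 hψn hpath
    (ε := (1 / 2) ^ n) (by positivity)
  let U : ℕ → Set (Cantor × Cantor) := fun m => ⋃ n, C (m + n)
  have hU : ∀ m, MeasurableSet (U m) := fun m => .iUnion fun n => hC _
  have hsub : ∀ m, C m ⊆ U m := fun m => subset_iUnion (fun n => C (m + n)) 0
  have hanti : Antitone U := fun i j hij => iUnion_subset fun n => by
    have := subset_iUnion (fun n => C (i + n)) (j - i + n)
    simpa only [show i + (j - i + n) = j + n by omega] using this
  have hvert : ∀ {S : Set (Cantor × Cantor)}, MeasurableSet S → ∀ x,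
      MeasurableSet {y | (x, y) ∈ S} := fun hS x => measurable_prodMk_left hS
  have hhor : ∀ {S : Set (Cantor × Cantor)}, MeasurableSet S → ∀ y,
      MeasurableSet {x | (x, y) ∈ S} := fun hS y => measurable_prodMk_right hS
  have hpow : Tendsto (fun n : ℕ => (1 / 2 : ℝ) ^ n) atTop (nhds 0) :=
    tendsto_pow_atTop_nhds_zero_of_lt_one (by norm_num) (by norm_num)
  refine ⟨⋂ m, U m, .iInter hU, fun x => ?_, fun y => ?_⟩
  · have hlim := hψ.2 (fun m => {y | (x, y) ∈ U m}) (fun m => hvert (hU m) x)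
      fun i j hij y hy => hanti hij hy
    have hset : ⋂ m, {y | (x, y) ∈ U m} = {y | (x, y) ∈ ⋂ m, U m} := by
      ext y; simp
    rw [hset] at hlim
    have h1 : Tendsto (fun n : ℕ => (1 - (1 / 2 : ℝ) ^ n) / 3) atTop (nhds ((1 - 0) / 3)) :=
      (hpow.const_sub 1).div_const 3
    have h2 := le_of_tendsto_of_tendsto' h1 (NNReal.tendsto_coe.2 hlim) fun n => by
      refine le_trans ?_ ((hCψ n x).trans (NNReal.coe_le_coe.2
        (hψ.1.2.1 _ _ (hvert (hC n) x) (hvert (hU n) x) fun y hy => hsub n hy)))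
      simp
    rw [← NNReal.coe_le_coe]
    push_cast
    linarith
  · have hle : ∀ m, φ {x | (x, y) ∈ ⋂ m, U m} ≤ 2 * (1 / 2) ^ m := fun m => by
      have h1 : {x | (x, y) ∈ ⋂ m, U m} ⊆ ⋃ n, {x | (x, y) ∈ C (m + n)} := fun x hx => by
        simpa [U] using mem_iInter.1 hx m
      refine (hφ.1.2.1 _ _ (hhor (.iInter hU) y) (.iUnion fun n => hhor (hC _) y) h1).trans
        (hφ.iUnion_le (fun n => hhor (hC _) y) fun n => ?_)
      refine (Finset.sum_le_sum fun i _ => hCφ (m + i) y).trans ?_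
      simp only [pow_add, ← Finset.mul_sum]
      rw [mul_comm]
      gcongr
      rw [← NNReal.coe_le_coe]
      push_cast
      exact sum_geometric_two_le n
    have hpow' : Tendsto (fun n : ℕ => 2 * (1 / 2 : ℝ≥0) ^ n) atTop (nhds (2 * 0)) :=
      (NNReal.tendsto_coe.1 (by simpa using hpow)).const_mul 2
    rw [mul_zero] at hpow'
    exact le_antisymm (ge_of_tendsto' hpow' hle) zero_le
end
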